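/- arXiv:0709.1205 — 2 statements merged into one kernel-verified Lean document; each statement's English description precedes it below -/
import Mathlib

section
/- For every atomic flow A there exists an atomic flow B such that A →_c* B and every ai-cycle of B is a fragile cycle (i.e., contains a simple edge). -/
set_option linter.unusedVariables false

namespace AF

/-! ### Formulae of system SKS.

Atoms are pairs `(n, b)`; the involution `ā` flips the Boolean, so it is
fixed-point free. -/

inductive Formula : Type
  | tt : Formula
  | ff : Formula
  | atom : ℕ → Bool → Formula
  | or : Formula → Formula → Formula
  | and : Formula → Formula → Formula
  deriving DecidableEq

namespace Formula

/-- Subformula at a position (`false` = left child, `true` = right child). -/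
def sub : Formula → List Bool → Option Formula
  | φ, [] => some φ
  | .or α _, false :: p => sub α p
  | .or _ β, true :: p => sub β p
  | .and α _, false :: p => sub α p
  | .and _ β, true :: p => sub β p
  | _, _ :: _ => none

/-- Replace the subformula at a position. -/
def repl : Formula → List Bool → Formula → Formula
  | _, [], ψ => ψ
  | .or α β, false :: p, ψ => .or (repl α p ψ) β
  | .or α β, true :: p, ψ => .or α (repl β p ψ)
  | .and α β, false :: p, ψ => .and (repl α p ψ) β
  | .and α β, true :: p, ψ => .and α (repl β p ψ)
  | φ, _ :: _, _ => φ

/-- `p` is an atom occurrence of `φ`. -/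
def IsOcc (φ : Formula) (p : List Bool) : Prop :=
  ∃ n b, φ.sub p = some (.atom n b)

end Formula

/-! ### Inference rules.

The rule `=` of SKS replaces a formula by an equivalent one under
commutativity, associativity and the unit equations; each single instance of
`=` applies one equation (in either direction), so we list the equations as
individual rule names, all marked as being instances of `=` via `isEq`. -/

inductive RuleName : Type
  | aiDown | aiUp | awDown | awUp | acDown | acUp
  | s | m
  | eqOrComm | eqAndComm
  | eqOrAssocL | eqOrAssocR | eqAndAssocL | eqAndAssocR
  | eqOrUnitDel | eqOrUnitAdd | eqAndUnitDel | eqAndUnitAdd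
  | eqTTDel | eqTTAdd | eqFFDel | eqFFAdd
  deriving DecidableEq

namespace RuleName

/-- The atomic structural rules. -/
def isStructural : RuleName → Bool
  | .aiDown | .aiUp | .awDown | .awUp | .acDown | .acUp => true
  | _ => false

/-- The rule names that are instances of the rule `=`. -/
def isEq : RuleName → Bool
  | .aiDown | .aiUp | .awDown | .awUp | .acDown | .acUp | .s | .m => false
  | _ => true

end RuleName

/-- Rule instances (redex ⟹ contractum). -/
inductive RuleInstance : RuleName → Formula → Formula → Prop
  | aiDown (n : ℕ) (b : Bool) :
      RuleInstance .aiDown .tt (.or (.atom n b) (.atom n (!b)))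
  | aiUp (n : ℕ) (b : Bool) :
      RuleInstance .aiUp (.and (.atom n b) (.atom n (!b))) .ff
  | awDown (n : ℕ) (b : Bool) : RuleInstance .awDown .ff (.atom n b)
  | awUp (n : ℕ) (b : Bool) : RuleInstance .awUp (.atom n b) .tt
  | acDown (n : ℕ) (b : Bool) :
      RuleInstance .acDown (.or (.atom n b) (.atom n b)) (.atom n b)
  | acUp (n : ℕ) (b : Bool) :
      RuleInstance .acUp (.atom n b) (.and (.atom n b) (.atom n b))
  | s (α β γ : Formula) :
      RuleInstance .s (.and α (.or β γ)) (.or (.and α β) γ)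
  | m (α β γ δ : Formula) :
      RuleInstance .m (.or (.and α β) (.and γ δ)) (.and (.or α γ) (.or β δ))
  | eqOrComm (α β : Formula) : RuleInstance .eqOrComm (.or α β) (.or β α)
  | eqAndComm (α β : Formula) : RuleInstance .eqAndComm (.and α β) (.and β α)
  | eqOrAssocL (α β γ : Formula) :
      RuleInstance .eqOrAssocL (.or (.or α β) γ) (.or α (.or β γ))
  | eqOrAssocR (α β γ : Formula) :
      RuleInstance .eqOrAssocR (.or α (.or β γ)) (.or (.or α β) γ)
  | eqAndAssocL (α β γ : Formula) :
      RuleInstance .eqAndAssocL (.and (.and α β) γ) (.and α (.and β γ))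
  | eqAndAssocR (α β γ : Formula) :
      RuleInstance .eqAndAssocR (.and α (.and β γ)) (.and (.and α β) γ)
  | eqOrUnitDel (α : Formula) : RuleInstance .eqOrUnitDel (.or α .ff) α
  | eqOrUnitAdd (α : Formula) : RuleInstance .eqOrUnitAdd α (.or α .ff)
  | eqAndUnitDel (α : Formula) : RuleInstance .eqAndUnitDel (.and α .tt) α
  | eqAndUnitAdd (α : Formula) : RuleInstance .eqAndUnitAdd α (.and α .tt)
  | eqTTDel : RuleInstance .eqTTDel (.or .tt .tt) .tt
  | eqTTAdd : RuleInstance .eqTTAdd .tt (.or .tt .tt)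
  | eqFFDel : RuleInstance .eqFFDel (.and .ff .ff) .ff
  | eqFFAdd : RuleInstance .eqFFAdd .ff (.and .ff .ff)

/-- One (deep) inference step applying rule `r` at position `q`. -/
def StepAt (r : RuleName) (q : List Bool) (φ ψ : Formula) : Prop :=
  ∃ γ δ, φ.sub q = some γ ∧ RuleInstance r γ δ ∧ ψ = φ.repl q δ

/-- One inference step using a rule from the set `S`. -/
def Step (S : Set RuleName) (φ ψ : Formula) : Prop :=
  ∃ r ∈ S, ∃ q, StepAt r q φ ψ

/-- There is a derivation from `φ` to `ψ` using only rules from `S`. -/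
def Derives (S : Set RuleName) : Formula → Formula → Prop :=
  Relation.ReflTransGen (Step S)

/-! ### Derivations as explicit data (for the theory of atomic flows). -/

/-- A derivation: a premiss and a chain of steps, each recorded by its rule
name, the position of the redex, and the resulting formula. -/
structure Deriv : Type where
  prem : Formula
  steps : List (RuleName × List Bool × Formula)

namespace Deriv

/-- The `i`-th step datum. -/
def stepAt (Φ : Deriv) (i : ℕ) : RuleName × List Bool × Formula :=
  Φ.steps.getD i (RuleName.s, ([] : List Bool), Formula.tt)

/-- The `i`-th formula of the derivation (`0` is the premiss). -/
def fml (Φ : Deriv) (i : ℕ) : Formula :=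
  (Φ.prem :: Φ.steps.map (fun t => t.2.2)).getD i Φ.prem

/-- Number of formulae in the derivation. -/
def nf (Φ : Deriv) : ℕ := Φ.steps.length + 1

/-- The conclusion of the derivation. -/
def concl (Φ : Deriv) : Formula := Φ.fml Φ.steps.length

/-- The derivation is well formed: every recorded step is a correct
inference step of SKS. -/
def WF (Φ : Deriv) : Prop :=
  ∀ i, i < Φ.steps.length →
    StepAt (Φ.stepAt i).1 (Φ.stepAt i).2.1 (Φ.fml i) (Φ.fml (i + 1))

end Deriv

/-! ### Atomic flows. -/

inductive FlowLabel : Type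
  | aiDown | aiUp | awDown | awUp | acDown | acUp
  deriving DecidableEq

/-- Required (number of lower edges, number of upper edges) of a vertex. -/
def labDeg : FlowLabel → ℕ × ℕ
  | .aiDown => (2, 0)
  | .aiUp => (0, 2)
  | .awDown => (1, 0)
  | .awUp => (0, 1)
  | .acDown => (1, 2)
  | .acUp => (2, 1)

/-- The data of an atomic flow: vertices, edges, labels, and the two
endpoint maps.  `up e = none` means the upper endpoint is `⊤`, and
`lo e = none` means the lower endpoint is `⊥`. -/
structure PreFlow : Type where
  V : Finset ℕ
  E : Finset ℕ
  η : ℕ → FlowLabel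
  up : ℕ → Option ℕ
  lo : ℕ → Option ℕ

namespace PreFlow

/-- Lower edges of a vertex. -/
def Ledges (F : PreFlow) (v : ℕ) : Finset ℕ :=
  F.E.filter (fun e => F.up e = some v)

/-- Upper edges of a vertex. -/
def Uedges (F : PreFlow) (v : ℕ) : Finset ℕ :=
  F.E.filter (fun e => F.lo e = some v)

/-- All edges of a vertex. -/
def edges (F : PreFlow) (v : ℕ) : Finset ℕ := F.Ledges v ∪ F.Uedges v

def degOK (F : PreFlow) : Prop :=
  ∀ v ∈ F.V, (F.Ledges v).card = (labDeg (F.η v)).1 ∧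
    (F.Uedges v).card = (labDeg (F.η v)).2

def endpointsOK (F : PreFlow) : Prop :=
  ∀ e ∈ F.E, (∀ v, F.up e = some v → v ∈ F.V) ∧
    (∀ v, F.lo e = some v → v ∈ F.V)

/-- No cyclic sequence of edges `ε₁, …, ε_h` with
`up (ε_i) = lo (ε_(i+1 mod h))`. -/
def Acyclic (F : PreFlow) : Prop :=
  ¬ ∃ (h : ℕ) (ε : Fin (h + 1) → ℕ), (∀ i, ε i ∈ F.E) ∧
      ∀ i : Fin (h + 1), (F.up (ε i)).isSome ∧ F.up (ε i) = F.lo (ε (i + 1))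

/-- `π` is a polarity assignment (`false` = `−`, `true` = `+`). -/
def PolarityOK (F : PreFlow) (π : ℕ → Bool) : Prop :=
  ∀ v ∈ F.V,
    ((F.η v = .acDown ∨ F.η v = .acUp) →
      ∀ e₁ ∈ F.edges v, ∀ e₂ ∈ F.edges v, π e₁ = π e₂) ∧
    ((F.η v = .aiDown ∨ F.η v = .aiUp) →
      ∃ e₁ ∈ F.edges v, ∃ e₂ ∈ F.edges v, π e₁ ≠ π e₂)

/-- `F` is an atomic flow. -/
def IsFlow (F : PreFlow) : Prop :=
  F.degOK ∧ F.endpointsOK ∧ F.Acyclic ∧ ∃ π, F.PolarityOK π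

end PreFlow

/-! ### Paths, ai-paths, cycles. -/

/-- An endpoint of a path: a vertex, or `⊤`, or `⊥`. -/
inductive VPt : Type
  | ver : ℕ → VPt
  | top : VPt
  | bot : VPt
  deriving DecidableEq

/-- The upper endpoint of edge `e` is `ν`. -/
def srcOK (F : PreFlow) (ν : VPt) (e : ℕ) : Prop :=
  match ν with
  | .ver v => F.up e = some v
  | .top => F.up e = none
  | .bot => False

/-- The lower endpoint of edge `e` is `ν`. -/
def tgtOK (F : PreFlow) (ν : VPt) (e : ℕ) : Prop :=
  match ν with
  | .ver v => F.lo e = some v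
  | .bot => F.lo e = none
  | .top => False

/-- A downward path from `ν` to `ν'` (a nonempty sequence of edges, each
hanging from the lower endpoint of the previous one). -/
def IsDownPath (F : PreFlow) (ν ν' : VPt) (l : List ℕ) : Prop :=
  l ≠ [] ∧ (∀ e ∈ l, e ∈ F.E) ∧
  (∀ i, i + 1 < l.length →
    ∃ v ∈ F.V, F.lo (l.getD i 0) = some v ∧ F.up (l.getD (i + 1) 0) = some v) ∧
  srcOK F ν (l.getD 0 0) ∧ tgtOK F ν' (l.getD (l.length - 1) 0)

/-- A path from `ν` to `ν'`: a downward path, or the reverse of a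
downward path from `ν'` to `ν`. -/
def IsPath (F : PreFlow) (ν ν' : VPt) (l : List ℕ) : Prop :=
  IsDownPath F ν ν' l ∨ IsDownPath F ν' ν l.reverse

/-- ai-paths: paths, closed under concatenation (in distinct edges) at
interaction and cointeraction vertices. -/
inductive AIPath (F : PreFlow) : VPt → VPt → List ℕ → Prop
  | single {ν ν' : VPt} {l : List ℕ} : IsPath F ν ν' l → AIPath F ν ν' l
  | join {ν ν' : VPt} {v : ℕ} {l₁ l₂ : List ℕ} {e e' : ℕ} :
      v ∈ F.V → (F.η v = .aiDown ∨ F.η v = .aiUp) →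
      AIPath F ν (.ver v) (l₁ ++ [e]) →
      AIPath F (.ver v) ν' (e' :: l₂) →
      e ≠ e' →
      AIPath F ν ν' (l₁ ++ [e] ++ e' :: l₂)

/-- The flow contains an ai-cycle: an ai-path from a vertex to itself in
which no edge appears twice. -/
def HasAICycle (F : PreFlow) : Prop :=
  ∃ v l, v ∈ F.V ∧ AIPath F (.ver v) (.ver v) l ∧ l.Nodup

def CycleFree (F : PreFlow) : Prop := ¬ HasAICycle F

/-- An ai-connection: a path from an interaction vertex to a cointeraction
vertex or vice versa. -/
def IsConnection (F : PreFlow) (l : List ℕ) : Prop :=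
  ∃ v v', v ∈ F.V ∧ v' ∈ F.V ∧
    ((F.η v = .aiDown ∧ F.η v' = .aiUp) ∨
     (F.η v = .aiUp ∧ F.η v' = .aiDown)) ∧
    IsPath F (.ver v) (.ver v') l

/-- A simple edge: an ai-connection consisting of a single edge. -/
def SimpleEdge (F : PreFlow) (e : ℕ) : Prop := IsConnection F [e]

/-- A clean path: an ai-path all of whose ai-connections are simple edges. -/
def IsCleanPath (F : PreFlow) (ν ν' : VPt) (l : List ℕ) : Prop :=
  AIPath F ν ν' l ∧
  ∀ l₁ l₂ l₃, l = l₁ ++ l₂ ++ l₃ → IsConnection F l₂ → l₂.length = 1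

/-! ### Local flow reduction rules. -/

open PreFlow

/-- Rule `w↓-c↓`: a weakening feeding a contraction is erased, merging the
contraction's other two edges. -/
def RedWdCd (A B : PreFlow) : Prop :=
  ∃ v₁ v₂ e e₂ e₃,
    v₁ ∈ A.V ∧ v₂ ∈ A.V ∧ v₁ ≠ v₂ ∧
    A.η v₁ = .awDown ∧ A.η v₂ = .acDown ∧
    e ∈ A.E ∧ e₂ ∈ A.E ∧ e₃ ∈ A.E ∧ e ≠ e₂ ∧ e ≠ e₃ ∧ e₂ ≠ e₃ ∧
    A.up e = some v₁ ∧ A.lo e = some v₂ ∧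
    A.lo e₂ = some v₂ ∧ A.up e₃ = some v₂ ∧
    B.V = (A.V.erase v₁).erase v₂ ∧
    B.E = (A.E.erase e).erase e₃ ∧
    B.η = A.η ∧ B.up = A.up ∧
    B.lo = Function.update A.lo e₂ (A.lo e₃)

/-- Rule `c↑-w↑` (dual of `w↓-c↓`). -/
def RedCuWu (A B : PreFlow) : Prop :=
  ∃ v₁ v₂ e e₂ e₃,
    v₁ ∈ A.V ∧ v₂ ∈ A.V ∧ v₁ ≠ v₂ ∧
    A.η v₁ = .awUp ∧ A.η v₂ = .acUp ∧
    e ∈ A.E ∧ e₂ ∈ A.E ∧ e₃ ∈ A.E ∧ e ≠ e₂ ∧ e ≠ e₃ ∧ e₂ ≠ e₃ ∧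
    A.lo e = some v₁ ∧ A.up e = some v₂ ∧
    A.up e₂ = some v₂ ∧ A.lo e₃ = some v₂ ∧
    B.V = (A.V.erase v₁).erase v₂ ∧
    B.E = (A.E.erase e).erase e₃ ∧
    B.η = A.η ∧ B.lo = A.lo ∧
    B.up = Function.update A.up e₂ (A.up e₃)

/-- Rule `w↓-i↑`: a weakening feeding a cointeraction is replaced by a
coweakening on the other cointeraction edge. -/
def RedWdIu (A B : PreFlow) : Prop :=
  ∃ v₁ v₂ e e₂,
    v₁ ∈ A.V ∧ v₂ ∈ A.V ∧ v₁ ≠ v₂ ∧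
    A.η v₁ = .awDown ∧ A.η v₂ = .aiUp ∧
    e ∈ A.E ∧ e₂ ∈ A.E ∧ e ≠ e₂ ∧
    A.up e = some v₁ ∧ A.lo e = some v₂ ∧ A.lo e₂ = some v₂ ∧
    B.V = A.V.erase v₁ ∧ B.E = A.E.erase e ∧
    B.η = Function.update A.η v₂ .awUp ∧
    B.up = A.up ∧ B.lo = A.lo

/-- Rule `i↓-w↑` (dual of `w↓-i↑`). -/
def RedIdWu (A B : PreFlow) : Prop :=
  ∃ v₁ v₂ e e₂,
    v₁ ∈ A.V ∧ v₂ ∈ A.V ∧ v₁ ≠ v₂ ∧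
    A.η v₁ = .awUp ∧ A.η v₂ = .aiDown ∧
    e ∈ A.E ∧ e₂ ∈ A.E ∧ e ≠ e₂ ∧
    A.lo e = some v₁ ∧ A.up e = some v₂ ∧ A.up e₂ = some v₂ ∧
    B.V = A.V.erase v₁ ∧ B.E = A.E.erase e ∧
    B.η = Function.update A.η v₂ .awDown ∧
    B.up = A.up ∧ B.lo = A.lo

/-- Rule `w↓-w↑`: a weakening joined to a coweakening is erased. -/
def RedWdWu (A B : PreFlow) : Prop :=
  ∃ v₁ v₂ e,
    v₁ ∈ A.V ∧ v₂ ∈ A.V ∧ v₁ ≠ v₂ ∧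
    A.η v₁ = .awDown ∧ A.η v₂ = .awUp ∧
    e ∈ A.E ∧ A.up e = some v₁ ∧ A.lo e = some v₂ ∧
    B.V = (A.V.erase v₁).erase v₂ ∧ B.E = A.E.erase e ∧
    B.η = A.η ∧ B.up = A.up ∧ B.lo = A.lo

/-- Rule `w↓-c↑`: a weakening feeding a cocontraction is replaced by two
weakenings. -/
def RedWdCu (A B : PreFlow) : Prop :=
  ∃ v₁ v₂ e e₁ e₂,
    v₁ ∈ A.V ∧ v₂ ∈ A.V ∧ v₁ ≠ v₂ ∧
    A.η v₁ = .awDown ∧ A.η v₂ = .acUp ∧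
    e ∈ A.E ∧ e₁ ∈ A.E ∧ e₂ ∈ A.E ∧ e ≠ e₁ ∧ e ≠ e₂ ∧ e₁ ≠ e₂ ∧
    A.up e = some v₁ ∧ A.lo e = some v₂ ∧
    A.up e₁ = some v₂ ∧ A.up e₂ = some v₂ ∧
    B.V = A.V ∧ B.E = A.E.erase e ∧
    B.η = Function.update A.η v₂ .awDown ∧
    B.up = Function.update A.up e₁ (some v₁) ∧
    B.lo = A.lo

/-- Rule `c↓-w↑` (dual of `w↓-c↑`). -/
def RedCdWu (A B : PreFlow) : Prop :=
  ∃ v₁ v₂ e e₁ e₂,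
    v₁ ∈ A.V ∧ v₂ ∈ A.V ∧ v₁ ≠ v₂ ∧
    A.η v₁ = .awUp ∧ A.η v₂ = .acDown ∧
    e ∈ A.E ∧ e₁ ∈ A.E ∧ e₂ ∈ A.E ∧ e ≠ e₁ ∧ e ≠ e₂ ∧ e₁ ≠ e₂ ∧
    A.lo e = some v₁ ∧ A.up e = some v₂ ∧
    A.lo e₁ = some v₂ ∧ A.lo e₂ = some v₂ ∧
    B.V = A.V ∧ B.E = A.E.erase e ∧
    B.η = Function.update A.η v₂ .awUp ∧
    B.lo = Function.update A.lo e₁ (some v₁) ∧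
    B.up = A.up

/-- Rule `c↓-i↑`: a contraction whose output edge enters a cointeraction is
replaced by a cocontraction on the other cointeraction edge followed by two
cointeractions. -/
def RedCdIu (A B : PreFlow) : Prop :=
  ∃ v₁ v₂ v₃ e e₁ e₂ e₃ g₁ g₂,
    v₁ ∈ A.V ∧ v₂ ∈ A.V ∧ v₁ ≠ v₂ ∧ v₃ ∉ A.V ∧
    A.η v₁ = .acDown ∧ A.η v₂ = .aiUp ∧
    e ∈ A.E ∧ e₁ ∈ A.E ∧ e₂ ∈ A.E ∧ e₃ ∈ A.E ∧
    e ≠ e₁ ∧ e ≠ e₂ ∧ e ≠ e₃ ∧ e₁ ≠ e₂ ∧ e₁ ≠ e₃ ∧ e₂ ≠ e₃ ∧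
    g₁ ∉ A.E ∧ g₂ ∉ A.E ∧ g₁ ≠ g₂ ∧
    A.lo e₁ = some v₁ ∧ A.lo e₂ = some v₁ ∧
    A.up e = some v₁ ∧ A.lo e = some v₂ ∧ A.lo e₃ = some v₂ ∧
    B.V = insert v₃ A.V ∧
    B.E = insert g₁ (insert g₂ (A.E.erase e)) ∧
    B.η = Function.update (Function.update A.η v₁ .acUp) v₃ .aiUp ∧
    B.up = Function.update (Function.update A.up g₁ (some v₁)) g₂ (some v₁) ∧
    B.lo = Function.update (Function.update (Function.update
      (Function.update (Function.update A.lo e₁ (some v₂)) e₂ (some v₃))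
        e₃ (some v₁)) g₁ (some v₂)) g₂ (some v₃)

/-- Rule `i↓-c↑` (dual of `c↓-i↑`). -/
def RedIdCu (A B : PreFlow) : Prop :=
  ∃ v₁ v₂ v₃ e e₁ e₂ e₃ g₁ g₂,
    v₁ ∈ A.V ∧ v₂ ∈ A.V ∧ v₁ ≠ v₂ ∧ v₃ ∉ A.V ∧
    A.η v₁ = .acUp ∧ A.η v₂ = .aiDown ∧
    e ∈ A.E ∧ e₁ ∈ A.E ∧ e₂ ∈ A.E ∧ e₃ ∈ A.E ∧
    e ≠ e₁ ∧ e ≠ e₂ ∧ e ≠ e₃ ∧ e₁ ≠ e₂ ∧ e₁ ≠ e₃ ∧ e₂ ≠ e₃ ∧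
    g₁ ∉ A.E ∧ g₂ ∉ A.E ∧ g₁ ≠ g₂ ∧
    A.up e₁ = some v₁ ∧ A.up e₂ = some v₁ ∧
    A.lo e = some v₁ ∧ A.up e = some v₂ ∧ A.up e₃ = some v₂ ∧
    B.V = insert v₃ A.V ∧
    B.E = insert g₁ (insert g₂ (A.E.erase e)) ∧
    B.η = Function.update (Function.update A.η v₁ .acDown) v₃ .aiDown ∧
    B.lo = Function.update (Function.update A.lo g₁ (some v₁)) g₂ (some v₁) ∧
    B.up = Function.update (Function.update (Function.update
      (Function.update (Function.update A.up e₁ (some v₂)) e₂ (some v₃))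
        e₃ (some v₁)) g₁ (some v₂)) g₂ (some v₃)

/-- Rule `c↓-c↑`: a contraction whose output enters a cocontraction is
replaced by two cocontractions above two contractions, crosswise connected. -/
def RedCdCu (A B : PreFlow) : Prop :=
  ∃ v₁ v₂ v₃ v₄ e e₁ e₂ e₃ e₄ g₁₁ g₁₂ g₂₁ g₂₂,
    v₁ ∈ A.V ∧ v₂ ∈ A.V ∧ v₁ ≠ v₂ ∧
    v₃ ∉ A.V ∧ v₄ ∉ A.V ∧ v₃ ≠ v₄ ∧
    A.η v₁ = .acDown ∧ A.η v₂ = .acUp ∧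
    e ∈ A.E ∧ e₁ ∈ A.E ∧ e₂ ∈ A.E ∧ e₃ ∈ A.E ∧ e₄ ∈ A.E ∧
    e ≠ e₁ ∧ e ≠ e₂ ∧ e ≠ e₃ ∧ e ≠ e₄ ∧
    e₁ ≠ e₂ ∧ e₁ ≠ e₃ ∧ e₁ ≠ e₄ ∧ e₂ ≠ e₃ ∧ e₂ ≠ e₄ ∧ e₃ ≠ e₄ ∧
    g₁₁ ∉ A.E ∧ g₁₂ ∉ A.E ∧ g₂₁ ∉ A.E ∧ g₂₂ ∉ A.E ∧
    g₁₁ ≠ g₁₂ ∧ g₁₁ ≠ g₂₁ ∧ g₁₁ ≠ g₂₂ ∧ g₁₂ ≠ g₂₁ ∧ g₁₂ ≠ g₂₂ ∧ g₂₁ ≠ g₂₂ ∧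
    A.lo e₁ = some v₁ ∧ A.lo e₂ = some v₁ ∧ A.up e = some v₁ ∧
    A.lo e = some v₂ ∧ A.up e₃ = some v₂ ∧ A.up e₄ = some v₂ ∧
    B.V = insert v₃ (insert v₄ A.V) ∧
    B.E = insert g₁₁ (insert g₁₂ (insert g₂₁ (insert g₂₂ (A.E.erase e)))) ∧
    B.η = Function.update (Function.update (Function.update
      (Function.update A.η v₁ .acUp) v₂ .acUp) v₃ .acDown) v₄ .acDown ∧
    B.up = Function.update (Function.update (Function.update
      (Function.update (Function.update (Function.update A.up
        e₃ (some v₃)) e₄ (some v₄)) g₁₁ (some v₁)) g₁₂ (some v₁))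
          g₂₁ (some v₂)) g₂₂ (some v₂) ∧
    B.lo = Function.update (Function.update (Function.update
      (Function.update (Function.update A.lo e₂ (some v₂)) g₁₁ (some v₃))
        g₁₂ (some v₄)) g₂₁ (some v₃)) g₂₂ (some v₄)

/-- One step of the flow rewriting system `w`. -/
def StepW (A B : PreFlow) : Prop :=
  RedWdCd A B ∨ RedCuWu A B ∨ RedWdIu A B ∨ RedIdWu A B ∨
  RedWdWu A B ∨ RedWdCu A B ∨ RedCdWu A B

/-- One step of the flow rewriting system `c`. -/
def StepC (A B : PreFlow) : Prop :=
  RedCdIu A B ∨ RedIdCu A B ∨ RedCdCu A B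

/-- `A` is normal for the flow rewriting system `w`. -/
def NormalW (A : PreFlow) : Prop := ¬ ∃ B, StepW A B

/-- `A` is normal for the flow rewriting system `c`. -/
def NormalC (A : PreFlow) : Prop := ¬ ∃ B, StepC A B

/-! ### Flow isomorphisms. -/

structure FlowIso (A B : PreFlow) : Type where
  vmap : ℕ → ℕ
  emap : ℕ → ℕ
  vbij : Set.BijOn vmap (A.V : Set ℕ) (B.V : Set ℕ)
  ebij : Set.BijOn emap (A.E : Set ℕ) (B.E : Set ℕ)
  lab : ∀ v ∈ A.V, B.η (vmap v) = A.η v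
  upc : ∀ e ∈ A.E, B.up (emap e) = (A.up e).map vmap
  loc : ∀ e ∈ A.E, B.lo (emap e) = (A.lo e).map vmap

/-! ### The global reduction `→se` (elimination of a simple edge). -/

/-- The flow obtained from `B` by eliminating the simple edge `e0` between
the interaction `vi` and the cointeraction `vc` (with `e2` the other lower
edge of `vi` and `e3` the other upper edge of `vc`): two copies (tags `0`,
hat, the lower one, and `1`, tilde, the upper one) of the remaining flow are
glued by identifying the hat copy of `e2` with the tilde copy of `e3`; a
weakening (vertex `(2,0)`) is placed above the tilde copy of `e2`, a
coweakening (vertex `(2,1)`) below the hat copy of `e3`; each upper edge `ε`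
of `B` gives a cocontraction (vertex `(3,ε)`, with a new upper edge `(3,ε)`)
joining the two copies of `ε`, and dually each lower edge `ε'` of `B` gives
a contraction (vertex `(4,ε')`, with a new lower edge `(4,ε')`). -/
def seFlow (B : PreFlow) (vi vc e0 e2 e3 : ℕ) : PreFlow :=
  { V := ((B.V.erase vi).erase vc).image (Nat.pair 0) ∪
         ((B.V.erase vi).erase vc).image (Nat.pair 1) ∪
         {Nat.pair 2 0, Nat.pair 2 1} ∪
         (B.E.filter (fun e => B.up e = none)).image (Nat.pair 3) ∪
         (B.E.filter (fun e => B.lo e = none)).image (Nat.pair 4),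
    E := (B.E.erase e0).image (Nat.pair 0) ∪
         (B.E.erase e0).image (fun e => if e = e3 then Nat.pair 0 e2 else Nat.pair 1 e) ∪
         (B.E.filter (fun e => B.up e = none)).image (Nat.pair 3) ∪
         (B.E.filter (fun e => B.lo e = none)).image (Nat.pair 4),
    η := fun x =>
      if (Nat.unpair x).1 = 2 then
        (if (Nat.unpair x).2 = 0 then FlowLabel.awDown else FlowLabel.awUp)
      else if (Nat.unpair x).1 = 3 then FlowLabel.acUp
      else if (Nat.unpair x).1 = 4 then FlowLabel.acDown
      else B.η (Nat.unpair x).2,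
    up := fun x =>
      let t := (Nat.unpair x).1
      let y := (Nat.unpair x).2
      if t = 0 then
        (if y = e2 then
          (match B.up e3 with
           | some v => some (Nat.pair 1 v)
           | none => some (Nat.pair 3 e3))
        else
          (match B.up y with
           | some v => some (Nat.pair 0 v)
           | none => some (Nat.pair 3 y)))
      else if t = 1 then
        (if y = e2 then some (Nat.pair 2 0)
        else
          (match B.up y with
           | some v => some (Nat.pair 1 v)
           | none => some (Nat.pair 3 y)))
      else if t = 3 then none
      else some (Nat.pair 4 y),
    lo := fun x =>
      let t := (Nat.unpair x).1
      let y := (Nat.unpair x).2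
      if t = 0 then
        (if y = e2 then
          (match B.lo e2 with
           | some v => some (Nat.pair 0 v)
           | none => some (Nat.pair 4 e2))
        else if y = e3 then some (Nat.pair 2 1)
        else
          (match B.lo y with
           | some v => some (Nat.pair 0 v)
           | none => some (Nat.pair 4 y)))
      else if t = 1 then
        (match B.lo y with
         | some v => some (Nat.pair 1 v)
         | none => some (Nat.pair 4 y))
      else if t = 3 then some (Nat.pair 3 y)
      else none }

/-- The reduction `→se`: elimination of a simple edge (up to flow
isomorphism). -/
def RedSE (B C : PreFlow) : Prop :=
  ∃ vi vc e0 e2 e3,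
    vi ∈ B.V ∧ vc ∈ B.V ∧ vi ≠ vc ∧
    B.η vi = .aiDown ∧ B.η vc = .aiUp ∧
    e0 ∈ B.E ∧ e2 ∈ B.E ∧ e3 ∈ B.E ∧
    e0 ≠ e2 ∧ e0 ≠ e3 ∧ e2 ≠ e3 ∧
    B.up e0 = some vi ∧ B.lo e0 = some vc ∧
    B.up e2 = some vi ∧ B.lo e3 = some vc ∧
    Nonempty (FlowIso C (seFlow B vi vc e0 e2 e3))

/-! ### The atomic flow associated with a derivation. -/

/-- Correspondence conditions for a linear rule applied at position `q`:
for each pair `(c₁, c₂)` in `cs`, occurrences at `q ++ c₁ ++ p` in the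
conclusion (formula `i+1`) are traced to occurrences at `q ++ c₂ ++ p` in
the premiss (formula `i`). -/
def corrCond (f : ℕ → List Bool → ℕ) (i : ℕ) (q : List Bool) (ψ : Formula)
    (cs : List (List Bool × List Bool)) : Prop :=
  ∀ c ∈ cs, ∀ p : List Bool, ψ.IsOcc (q ++ c.1 ++ p) →
    f (i + 1) (q ++ c.1 ++ p) = f i (q ++ c.2 ++ p)

/-- The tracing conditions for one inference step: occurrences in the
context are traced to the same edge, and the active occurrences of a
structural rule are related to the edges of the vertex `v` as prescribed by
its label, while the active occurrences of logical and `=` steps are traced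
to the same edges under the canonical correspondence. -/
def stepCond (A : PreFlow) (f : ℕ → List Bool → ℕ) (v : ℕ) (i : ℕ)
    (r : RuleName) (q : List Bool) (φ ψ : Formula) : Prop :=
  (∀ p, ¬ (q <+: p) → φ.IsOcc p → f (i + 1) p = f i p) ∧
  match r with
  | .aiDown =>
      A.η v = .aiDown ∧
      A.up (f (i + 1) (q ++ [false])) = some v ∧
      A.up (f (i + 1) (q ++ [true])) = some v ∧
      f (i + 1) (q ++ [false]) ≠ f (i + 1) (q ++ [true])
  | .aiUp =>
      A.η v = .aiUp ∧
      A.lo (f i (q ++ [false])) = some v ∧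
      A.lo (f i (q ++ [true])) = some v ∧
      f i (q ++ [false]) ≠ f i (q ++ [true])
  | .awDown => A.η v = .awDown ∧ A.up (f (i + 1) q) = some v
  | .awUp => A.η v = .awUp ∧ A.lo (f i q) = some v
  | .acDown =>
      A.η v = .acDown ∧
      A.lo (f i (q ++ [false])) = some v ∧
      A.lo (f i (q ++ [true])) = some v ∧
      A.up (f (i + 1) q) = some v ∧
      f i (q ++ [false]) ≠ f i (q ++ [true])
  | .acUp =>
      A.η v = .acUp ∧
      A.lo (f i q) = some v ∧
      A.up (f (i + 1) (q ++ [false])) = some v ∧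
      A.up (f (i + 1) (q ++ [true])) = some v ∧
      f (i + 1) (q ++ [false]) ≠ f (i + 1) (q ++ [true])
  | .s => corrCond f i q ψ
      [([false, false], [false]), ([false, true], [true, false]),
       ([true], [true, true])]
  | .m => corrCond f i q ψ
      [([false, false], [false, false]), ([true, false], [false, true]),
       ([false, true], [true, false]), ([true, true], [true, true])]
  | .eqOrComm => corrCond f i q ψ [([false], [true]), ([true], [false])]
  | .eqAndComm => corrCond f i q ψ [([false], [true]), ([true], [false])]
  | .eqOrAssocL => corrCond f i q ψ
      [([false], [false, false]), ([true, false], [false, true]),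
       ([true, true], [true])]
  | .eqOrAssocR => corrCond f i q ψ
      [([false, false], [false]), ([false, true], [true, false]),
       ([true], [true, true])]
  | .eqAndAssocL => corrCond f i q ψ
      [([false], [false, false]), ([true, false], [false, true]),
       ([true, true], [true])]
  | .eqAndAssocR => corrCond f i q ψ
      [([false, false], [false]), ([false, true], [true, false]),
       ([true], [true, true])]
  | .eqOrUnitDel => corrCond f i q ψ [([], [false])]
  | .eqOrUnitAdd => corrCond f i q ψ [([false], [])]
  | .eqAndUnitDel => corrCond f i q ψ [([], [false])]
  | .eqAndUnitAdd => corrCond f i q ψ [([false], [])]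
  | .eqTTDel => True
  | .eqTTAdd => True
  | .eqFFDel => True
  | .eqFFAdd => True

/-- `A` is the atomic flow associated with the derivation `Φ`, where `f`
maps each atom occurrence (formula index, position) of `Φ` to an edge of
`A`, and `g` assigns to each structural inference step its vertex. -/
def IsAssocFlow (Φ : Deriv) (A : PreFlow) (f : ℕ → List Bool → ℕ)
    (g : ℕ → ℕ) : Prop :=
  Φ.WF ∧ A.IsFlow ∧
  (∀ i p, i < Φ.nf → (Φ.fml i).IsOcc p → f i p ∈ A.E) ∧
  (∀ e ∈ A.E, ∃ i p, i < Φ.nf ∧ (Φ.fml i).IsOcc p ∧ f i p = e) ∧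
  (∀ i p p', i < Φ.nf → (Φ.fml i).IsOcc p → (Φ.fml i).IsOcc p' →
    f i p = f i p' → p = p') ∧
  (∀ p, (Φ.fml 0).IsOcc p → A.up (f 0 p) = none) ∧
  (∀ p, (Φ.fml Φ.steps.length).IsOcc p → A.lo (f Φ.steps.length p) = none) ∧
  (∀ i, i < Φ.steps.length → (Φ.stepAt i).1.isStructural = true → g i ∈ A.V) ∧
  (∀ v ∈ A.V, ∃ i, i < Φ.steps.length ∧
    (Φ.stepAt i).1.isStructural = true ∧ g i = v) ∧
  (∀ i j, i < Φ.steps.length → j < Φ.steps.length →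
    (Φ.stepAt i).1.isStructural = true → (Φ.stepAt j).1.isStructural = true →
    g i = g j → i = j) ∧
  (∀ i, i < Φ.steps.length →
    stepCond A f (g i) i (Φ.stepAt i).1 (Φ.stepAt i).2.1
      (Φ.fml i) (Φ.fml (i + 1)))

/-! ### Streamlining. -/

/-- No path from an interaction or weakening vertex to a cointeraction or
coweakening vertex. -/
def NoIWPath (A : PreFlow) : Prop :=
  ¬ ∃ v v' l, v ∈ A.V ∧ v' ∈ A.V ∧
      (A.η v = .aiDown ∨ A.η v = .awDown) ∧
      (A.η v' = .aiUp ∨ A.η v' = .awUp) ∧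
      IsPath A (.ver v) (.ver v') l

/-- `Φ` is a streamlined derivation. -/
def Streamlined (Φ : Deriv) : Prop :=
  ∃ A f g, IsAssocFlow Φ A f g ∧ NoIWPath A

/-- `Φ` is a super-streamlined derivation. -/
def SuperStreamlined (Φ : Deriv) : Prop :=
  ∃ A f g, IsAssocFlow Φ A f g ∧ NoIWPath A ∧ NormalW A

/-- `Φ` is a hyper-streamlined derivation. -/
def HyperStreamlined (Φ : Deriv) : Prop :=
  ∃ A f g, IsAssocFlow Φ A f g ∧ NoIWPath A ∧ NormalW A ∧ NormalC A

end AF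

namespace AF

open PreFlow

/-- The excess of a vertex label: cocontractions and cointeractions count once. -/
def labExcess : FlowLabel → ℕ
  | .acUp | .aiUp => 1
  | _ => 0

/-- Local conditions at a vertex with label `k`, lower edges `L` and upper edges `U`:
degrees, polarities `π`, and the decrease of the edge weights `d` along positive edges. -/
structure VertexOK (k : FlowLabel) (L U : Finset ℕ) (π : ℕ → Bool) (d : ℕ → ℕ) : Prop where
  cardL : L.card = (labDeg k).1
  cardU : U.card = (labDeg k).2
  polAc : k = .acDown ∨ k = .acUp → ∀ e ∈ L ∪ U, ∀ e' ∈ L ∪ U, π e = π e'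
  polAi : k = .aiDown ∨ k = .aiUp → ∀ e ∈ L ∪ U, ∀ e' ∈ L ∪ U, e ≠ e' → π e ≠ π e'
  bound : ∀ e ∈ U, π e = true → labExcess k + ∑ x ∈ L, d x ≤ d e

namespace VertexOK

variable {k : FlowLabel} {L U : Finset ℕ} {π π' : ℕ → Bool} {d d' : ℕ → ℕ}

theorem congr (h : VertexOK k L U π d) (hπ : ∀ e ∈ L ∪ U, π' e = π e)
    (hd : ∀ e ∈ L ∪ U, d' e = d e) : VertexOK k L U π' d' where
  cardL := h.cardL
  cardU := h.cardU
  polAc hk e he e' he' := by rw [hπ e he, hπ e' he']; exact h.polAc hk e he e' he'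
  polAi hk e he e' he' := by rw [hπ e he, hπ e' he']; exact h.polAi hk e he e' he'
  bound e he hp := by
    have he' := Finset.mem_union_right L he
    rw [hd e he', Finset.sum_congr rfl fun x hx => hd x (Finset.mem_union_left U hx)]
    exact h.bound e he (hπ e he' ▸ hp)

theorem acUp_iff {a b c : ℕ} (hab : a ≠ b) :
    VertexOK .acUp {a, b} {c} π d ↔
      π a = π c ∧ π b = π c ∧ (π c = true → 1 + d a + d b ≤ d c) := by
  constructor
  · intro h
    have := h.bound c (by simp)
    rw [Finset.sum_pair hab] at this
    exact ⟨h.polAc (by simp) a (by simp) c (by simp), h.polAc (by simp) b (by simp) c (by simp),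
      fun hc => by simpa [labExcess, add_assoc] using this hc⟩
  · rintro ⟨ha, hb, hc⟩
    refine ⟨Finset.card_pair hab, rfl, ?_, by simp, ?_⟩
    · simp [ha, hb]
    · simpa [labExcess, Finset.sum_pair hab, add_assoc] using hc

theorem acDown_iff {a b c : ℕ} (hab : a ≠ b) :
    VertexOK .acDown {c} {a, b} π d ↔
      π a = π c ∧ π b = π c ∧ (π c = true → d c ≤ d a ∧ d c ≤ d b) := by
  constructor
  · intro h
    have ha := h.polAc (by simp) a (by simp) c (by simp)
    have hb := h.polAc (by simp) b (by simp) c (by simp)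
    refine ⟨ha, hb, fun hc => ⟨?_, ?_⟩⟩
    · simpa [labExcess] using h.bound a (by simp) (ha.trans hc)
    · simpa [labExcess] using h.bound b (by simp) (hb.trans hc)
  · rintro ⟨ha, hb, hc⟩
    refine ⟨rfl, Finset.card_pair hab, ?_, by simp, ?_⟩
    · simp [ha, hb]
    · simpa [labExcess, ha, hb, ← forall_and] using hc

theorem aiUp_iff {a b : ℕ} (hab : a ≠ b) :
    VertexOK .aiUp ∅ {a, b} π d ↔
      π a ≠ π b ∧ (π a = true → 1 ≤ d a) ∧ (π b = true → 1 ≤ d b) := by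
  constructor
  · intro h
    exact ⟨h.polAi (by simp) a (by simp) b (by simp) hab,
      fun hc => by simpa [labExcess] using h.bound a (by simp) hc,
      fun hc => by simpa [labExcess] using h.bound b (by simp) hc⟩
  · rintro ⟨h, ha, hb⟩
    refine ⟨rfl, Finset.card_pair hab, by simp, ?_, ?_⟩
    · simp [hab, hab.symm, h, h.symm]
    · simpa [labExcess] using ⟨ha, hb⟩

theorem aiDown_iff {a b : ℕ} (hab : a ≠ b) :
    VertexOK .aiDown {a, b} ∅ π d ↔ π a ≠ π b := by
  constructor
  · intro h
    exact h.polAi (by simp) a (by simp) b (by simp) hab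
  · intro h
    refine ⟨Finset.card_pair hab, rfl, by simp, ?_, by simp⟩
    simp [hab, hab.symm, h, h.symm]

end VertexOK

/-- A flow with polarities `π`, heights `ht` increasing downwards (witnessing acyclicity) and
edge weights `d` satisfying the local conditions `VertexOK`. -/
structure Graded (A : PreFlow) (π : ℕ → Bool) (ht : ℕ → ℤ) (d : ℕ → ℕ) : Prop where
  ends : A.endpointsOK
  vert : ∀ v ∈ A.V, VertexOK (A.η v) (A.Ledges v) (A.Uedges v) π d
  height : ∀ e ∈ A.E, ∀ u w, A.up e = some u → A.lo e = some w → ht u < ht w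

/-- The edge `e` is positive and hangs from a contraction or an interaction. -/
def IsHeavy (A : PreFlow) (π : ℕ → Bool) (e : ℕ) : Prop :=
  π e = true ∧ ∃ v, A.up e = some v ∧ (A.η v = .acDown ∨ A.η v = .aiDown)

open Classical in
/-- Total weight of the positive edges hanging from contractions and interactions. -/
noncomputable def weight (A : PreFlow) (π : ℕ → Bool) (d : ℕ → ℕ) : ℕ :=
  ∑ e ∈ A.E with IsHeavy A π e, d e

theorem mem_Ledges {A : PreFlow} {v e : ℕ} : e ∈ A.Ledges v ↔ e ∈ A.E ∧ A.up e = some v := by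
  simp [Ledges]

theorem mem_Uedges {A : PreFlow} {v e : ℕ} : e ∈ A.Uedges v ↔ e ∈ A.E ∧ A.lo e = some v := by
  simp [Uedges]

theorem weight_lt {A B : PreFlow} {π π' : ℕ → Bool} {d d' : ℕ → ℕ} {e : ℕ} (P : Finset ℕ)
    (he : e ∈ A.E) (hA : IsHeavy A π e)
    (hB : ∀ x ∈ B.E, IsHeavy B π' x →
      d' x = d x ∧ (x ∈ P ∨ x ∈ A.E ∧ x ≠ e ∧ IsHeavy A π x))
    (hP : ∑ x ∈ P, d x < d e) : weight B π' d' < weight A π d := by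
  classical
  unfold weight
  calc ∑ x ∈ B.E with IsHeavy B π' x, d' x
      = ∑ x ∈ B.E with IsHeavy B π' x, d x := by
        refine Finset.sum_congr rfl fun x hx => ?_
        rw [Finset.mem_filter] at hx
        exact (hB x hx.1 hx.2).1
    _ ≤ ∑ x ∈ P ∪ {x ∈ A.E | IsHeavy A π x}.erase e, d x := by
        refine Finset.sum_le_sum_of_subset fun x hx => ?_
        rw [Finset.mem_filter] at hx
        have := (hB x hx.1 hx.2).2
        simp only [Finset.mem_union, Finset.mem_erase, Finset.mem_filter]
        tauto
    _ ≤ ∑ x ∈ P, d x + ∑ x ∈ {x ∈ A.E | IsHeavy A π x}.erase e, d x := by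
        rw [← Finset.sum_union_inter]
        exact Nat.le_add_right _ _
    _ < d e + ∑ x ∈ {x ∈ A.E | IsHeavy A π x}.erase e, d x := by gcongr
    _ = ∑ x ∈ A.E with IsHeavy A π x, d x :=
        Finset.add_sum_erase _ _ (by simp [he, hA])

theorem exists_eq_pair {s : Finset ℕ} {a : ℕ} (hs : s.card = 2) (ha : a ∈ s) :
    ∃ b, a ≠ b ∧ s = {a, b} := by
  obtain ⟨x, y, hxy, rfl⟩ := Finset.card_eq_two.1 hs
  rcases Finset.mem_insert.1 ha with rfl | h
  · exact ⟨y, hxy, rfl⟩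
  · obtain rfl := Finset.mem_singleton.1 h
    exact ⟨x, hxy.symm, Finset.pair_comm _ _⟩

theorem exists_eq_singleton {s : Finset ℕ} {a : ℕ} (hs : s.card = 1) (ha : a ∈ s) : s = {a} := by
  obtain ⟨x, rfl⟩ := Finset.card_eq_one.1 hs
  rw [Finset.mem_singleton.1 ha]

set_option maxHeartbeats 1000000 in
theorem exists_step_contraction_cocontraction {A : PreFlow} {π : ℕ → Bool} {ht : ℕ → ℤ}
    {d : ℕ → ℕ} (h : Graded A π ht d) {e v₁ v₂ : ℕ} (he : e ∈ A.E) (hπ : π e = true)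
    (hv₁e : A.up e = some v₁) (hv₂e : A.lo e = some v₂)
    (hη₁ : A.η v₁ = .acDown) (hη₂ : A.η v₂ = .acUp) :
    ∃ B π' ht' d', StepC A B ∧ Graded B π' ht' d' ∧ weight B π' d' < weight A π d := by
  have hends := h.ends
  have hheight := h.height
  have hlt := h.height e he _ _ hv₁e hv₂e
  have hv₁ : v₁ ∈ A.V := (h.ends e he).1 _ hv₁e
  have hv₂ : v₂ ∈ A.V := (h.ends e he).2 _ hv₂e
  have hne : v₁ ≠ v₂ := by grind
  have ok₁ := h.vert v₁ hv₁
  have ok₂ := h.vert v₂ hv₂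
  rw [hη₁] at ok₁
  rw [hη₂] at ok₂
  obtain ⟨e₁, e₂, h₁₂, hU₁⟩ := Finset.card_eq_two.1 ok₁.cardU
  obtain ⟨e₃, e₄, h₃₄, hL₂⟩ := Finset.card_eq_two.1 ok₂.cardL
  have hL₁ := exists_eq_singleton ok₁.cardL (mem_Ledges.2 ⟨he, hv₁e⟩)
  have hU₂ := exists_eq_singleton ok₂.cardU (mem_Uedges.2 ⟨he, hv₂e⟩)
  rw [hL₁, hU₁, VertexOK.acDown_iff h₁₂] at ok₁
  rw [hL₂, hU₂, VertexOK.acUp_iff h₃₄] at ok₂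
  have mL₁ : ∀ x, x ∈ A.E ∧ A.up x = some v₁ ↔ x = e := fun x => by
    rw [← mem_Ledges, hL₁]; simp
  have mU₁ : ∀ x, x ∈ A.E ∧ A.lo x = some v₁ ↔ x = e₁ ∨ x = e₂ := fun x => by
    rw [← mem_Uedges, hU₁]; simp
  have mL₂ : ∀ x, x ∈ A.E ∧ A.up x = some v₂ ↔ x = e₃ ∨ x = e₄ := fun x => by
    rw [← mem_Ledges, hL₂]; simp
  have mU₂ : ∀ x, x ∈ A.E ∧ A.lo x = some v₂ ↔ x = e := fun x => by
    rw [← mem_Uedges, hU₂]; simp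
  obtain ⟨v₃, hv₃⟩ := Infinite.exists_notMem_finset A.V
  obtain ⟨v₄, hv₄⟩ := Infinite.exists_notMem_finset (insert v₃ A.V)
  obtain ⟨g₁₁, hg₁₁⟩ := Infinite.exists_notMem_finset A.E
  obtain ⟨g₁₂, hg₁₂⟩ := Infinite.exists_notMem_finset (insert g₁₁ A.E)
  obtain ⟨g₂₁, hg₂₁⟩ := Infinite.exists_notMem_finset (insert g₁₂ (insert g₁₁ A.E))
  obtain ⟨g₂₂, hg₂₂⟩ := Infinite.exists_notMem_finset (insert g₂₁ (insert g₁₂ (insert g₁₁ A.E)))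
  simp only [Finset.mem_insert, not_or] at hv₄ hg₁₂ hg₂₁ hg₂₂
  obtain ⟨B, hB⟩ : ∃ B : PreFlow, B =
    { V := insert v₃ (insert v₄ A.V)
      E := insert g₁₁ (insert g₁₂ (insert g₂₁ (insert g₂₂ (A.E.erase e))))
      η := Function.update (Function.update (Function.update
        (Function.update A.η v₁ .acUp) v₂ .acUp) v₃ .acDown) v₄ .acDown
      up := Function.update (Function.update (Function.update
        (Function.update (Function.update (Function.update A.up
          e₃ (some v₃)) e₄ (some v₄)) g₁₁ (some v₁)) g₁₂ (some v₁))
            g₂₁ (some v₂)) g₂₂ (some v₂)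
      lo := Function.update (Function.update (Function.update
        (Function.update (Function.update A.lo e₂ (some v₂)) g₁₁ (some v₃))
          g₁₂ (some v₄)) g₂₁ (some v₃)) g₂₂ (some v₄) } := ⟨_, rfl⟩
  have BV : ∀ v, v ∈ B.V ↔ v ∈ insert v₃ (insert v₄ A.V) := by simp [hB]
  have BE : ∀ x, x ∈ B.E ↔ x ∈ insert g₁₁ (insert g₁₂ (insert g₂₁ (insert g₂₂ (A.E.erase e)))) := by simp [hB]
  have Bη : ∀ v, B.η v = (Function.update (Function.update (Function.update
        (Function.update A.η v₁ .acUp) v₂ .acUp) v₃ .acDown) v₄ .acDown : ℕ → FlowLabel) v := by simp [hB]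
  have Bup : ∀ x, B.up x = (Function.update (Function.update (Function.update
        (Function.update (Function.update (Function.update A.up
          e₃ (some v₃)) e₄ (some v₄)) g₁₁ (some v₁)) g₁₂ (some v₁))
            g₂₁ (some v₂)) g₂₂ (some v₂) : ℕ → Option ℕ) x := by simp [hB]
  have Blo : ∀ x, B.lo x = (Function.update (Function.update (Function.update
        (Function.update (Function.update A.lo e₂ (some v₂)) g₁₁ (some v₃))
          g₁₂ (some v₄)) g₂₁ (some v₃)) g₂₂ (some v₄) : ℕ → Option ℕ) x := by simp [hB]
  simp only [Finset.mem_insert, Finset.mem_erase] at BV BE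
  simp only [Function.update_apply] at Bη Bup Blo
  unfold endpointsOK at hends
  obtain ⟨h1E, h1lo⟩ := (mU₁ e₁).2 (.inl rfl)
  obtain ⟨h2E, h2lo⟩ := (mU₁ e₂).2 (.inr rfl)
  obtain ⟨h3E, h3up⟩ := (mL₂ e₃).2 (.inl rfl)
  obtain ⟨h4E, h4up⟩ := (mL₂ e₄).2 (.inr rfl)
  have h₁₃ : e₁ ≠ e₃ := by grind
  have h₁₄ : e₁ ≠ e₄ := by grind
  have h₂₃ : e₂ ≠ e₃ := by grind
  have h₂₄ : e₂ ≠ e₄ := by grind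
  have h₁ : e ≠ e₁ ∧ e ≠ e₂ ∧ e ≠ e₃ ∧ e ≠ e₄ := by grind
  have L₁ : B.Ledges v₁ = {g₁₁, g₁₂} := by
    ext x
    rw [mem_Ledges, BE, Bup]
    grind
  have L₂ : B.Ledges v₂ = {g₂₁, g₂₂} := by
    ext x
    rw [mem_Ledges, BE, Bup]
    grind
  have L₃ : B.Ledges v₃ = {e₃} := by
    ext x
    rw [mem_Ledges, BE, Bup]
    grind
  have L₄ : B.Ledges v₄ = {e₄} := by
    ext x
    rw [mem_Ledges, BE, Bup]
    grind
  have U₁ : B.Uedges v₁ = {e₁} := by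
    ext x
    rw [mem_Uedges, BE, Blo]
    grind
  have U₂ : B.Uedges v₂ = {e₂} := by
    ext x
    rw [mem_Uedges, BE, Blo]
    grind
  have U₃ : B.Uedges v₃ = {g₁₁, g₂₁} := by
    ext x
    rw [mem_Uedges, BE, Blo]
    grind
  have U₄ : B.Uedges v₄ = {g₁₂, g₂₂} := by
    ext x
    rw [mem_Uedges, BE, Blo]
    grind
  have L' : ∀ v ∈ A.V, v ≠ v₁ → v ≠ v₂ → B.Ledges v = A.Ledges v := by
    intro v hv n₁ n₂
    ext x
    rw [mem_Ledges, mem_Ledges, BE, Bup]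
    grind
  have U' : ∀ v ∈ A.V, v ≠ v₁ → v ≠ v₂ → B.Uedges v = A.Uedges v := by
    intro v hv n₁ n₂
    ext x
    rw [mem_Uedges, mem_Uedges, BE, Blo]
    grind
  let π' : ℕ → Bool := fun x => if x = g₁₁ ∨ x = g₁₂ ∨ x = g₂₁ ∨ x = g₂₂ then true else π x
  let d' : ℕ → ℕ := fun x =>
    if x = g₁₁ ∨ x = g₂₁ then d e₃ else if x = g₁₂ ∨ x = g₂₂ then d e₄ else d x
  let ht' := Function.update (Function.update (Function.update ht v₂ (ht v₁)) v₃ (ht v₂)) v₄ (ht v₂)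
  refine ⟨B, π', ht', d', ?_, ⟨?_, ?_, ?_⟩, ?_⟩
  · refine .inr (.inr ⟨v₁, v₂, v₃, v₄, e, e₁, e₂, e₃, e₄, g₁₁, g₁₂, g₂₁, g₂₂, ?_⟩)
    clear BV BE Bη Bup Blo L' U' L₁ L₂ L₃ U₁ U₂ U₃ L₄ U₄ hends hheight mL₁ mU₁ mL₂ mU₂
    simp only [hB, true_and]
    grind
  · intro x hx
    rw [BE] at hx
    have hends' := hends x
    constructor <;> intro v hv <;> simp only [BV, Bup, Blo] at hv ⊢ <;> grind (splits := 15)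
  · intro v hv
    have hv' : v = v₁ ∨ v = v₂ ∨ v = v₃ ∨ v = v₄ ∨ v ∈ A.V ∧ v ≠ v₁ ∧ v ≠ v₂ := by
      rw [BV] at hv
      grind
    rcases hv' with rfl | rfl | rfl | rfl | ⟨hvA, n₁, n₂⟩
    · have : B.η v = .acUp := by grind
      rw [this, L₁, U₁, VertexOK.acUp_iff (by grind)]
      grind
    · have : B.η v = .acUp := by grind
      rw [this, L₂, U₂, VertexOK.acUp_iff (by grind)]
      grind
    · have : B.η v = .acDown := by grind
      rw [this, L₃, U₃, VertexOK.acDown_iff (by grind)]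
      grind
    · have : B.η v = .acDown := by grind
      rw [this, L₄, U₄, VertexOK.acDown_iff (by grind)]
      grind
    · have : B.η v = A.η v := by grind
      rw [this, L' v hvA n₁ n₂, U' v hvA n₁ n₂]
      refine (h.vert v hvA).congr (fun x hx => ?_) fun x hx => ?_ <;>
      · rw [Finset.mem_union, mem_Ledges, mem_Uedges] at hx
        grind
  · intro x hx u w hu hw
    have key := hheight x
    have hu' := hends x
    rw [BE] at hx
    rw [Bup] at hu
    rw [Blo] at hw
    clear BV BE Bη Bup Blo hB L' U' L₁ L₂ L₃ U₁ U₂ U₃ L₄ U₄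
    simp only [ht', Function.update_apply]
    rcases hx with rfl | rfl | rfl | rfl | ⟨hxe, hxA⟩
    all_goals grind (splits := 20)
  · refine weight_lt {e₃, e₄} he ⟨hπ, v₁, hv₁e, .inl hη₁⟩ (fun x hx hh => ?_) ?_
    · obtain ⟨hp, v, hv, hk⟩ := hh
      rw [BE] at hx
      rw [Bup] at hv
      rw [Bη] at hk
      simp only [IsHeavy, Finset.mem_insert, Finset.mem_singleton]
      grind
    · rw [Finset.sum_pair h₃₄]
      grind

set_option maxHeartbeats 1000000 in
theorem exists_step_contraction_cointeraction {A : PreFlow} {π : ℕ → Bool} {ht : ℕ → ℤ}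
    {d : ℕ → ℕ} (h : Graded A π ht d) {e v₁ v₂ : ℕ} (he : e ∈ A.E) (hπ : π e = true)
    (hv₁e : A.up e = some v₁) (hv₂e : A.lo e = some v₂)
    (hη₁ : A.η v₁ = .acDown) (hη₂ : A.η v₂ = .aiUp) :
    ∃ B π' ht' d', StepC A B ∧ Graded B π' ht' d' ∧ weight B π' d' < weight A π d := by
  have hends := h.ends
  have hheight := h.height
  have hlt := h.height e he _ _ hv₁e hv₂e
  have hv₁ : v₁ ∈ A.V := (h.ends e he).1 _ hv₁e
  have hv₂ : v₂ ∈ A.V := (h.ends e he).2 _ hv₂e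
  have hne : v₁ ≠ v₂ := by grind
  have ok₁ := h.vert v₁ hv₁
  have ok₂ := h.vert v₂ hv₂
  rw [hη₁] at ok₁
  rw [hη₂] at ok₂
  obtain ⟨e₁, e₂, h₁₂, hU₁⟩ := Finset.card_eq_two.1 ok₁.cardU
  obtain ⟨e₃, h₃, hU₂⟩ := exists_eq_pair ok₂.cardU (mem_Uedges.2 ⟨he, hv₂e⟩)
  have hL₁ := exists_eq_singleton ok₁.cardL (mem_Ledges.2 ⟨he, hv₁e⟩)
  have hL₂ := Finset.card_eq_zero.1 ok₂.cardL
  rw [hL₁, hU₁, VertexOK.acDown_iff h₁₂] at ok₁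
  rw [hL₂, hU₂, VertexOK.aiUp_iff h₃] at ok₂
  have mL₁ : ∀ x, x ∈ A.E ∧ A.up x = some v₁ ↔ x = e := fun x => by
    rw [← mem_Ledges, hL₁]; simp
  have mU₁ : ∀ x, x ∈ A.E ∧ A.lo x = some v₁ ↔ x = e₁ ∨ x = e₂ := fun x => by
    rw [← mem_Uedges, hU₁]; simp
  have mL₂ : ∀ x, x ∈ A.E ∧ A.up x = some v₂ ↔ False := fun x => by
    rw [← mem_Ledges, hL₂]; simp
  have mU₂ : ∀ x, x ∈ A.E ∧ A.lo x = some v₂ ↔ x = e ∨ x = e₃ := fun x => by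
    rw [← mem_Uedges, hU₂]; simp
  obtain ⟨v₃, hv₃⟩ := Infinite.exists_notMem_finset A.V
  obtain ⟨g₁, hg₁⟩ := Infinite.exists_notMem_finset A.E
  obtain ⟨g₂, hg₂⟩ := Infinite.exists_notMem_finset (insert g₁ A.E)
  simp only [Finset.mem_insert, not_or] at hg₂
  obtain ⟨B, hB⟩ : ∃ B : PreFlow, B =
    { V := insert v₃ A.V
      E := insert g₁ (insert g₂ (A.E.erase e))
      η := Function.update (Function.update A.η v₁ .acUp) v₃ .aiUp
      up := Function.update (Function.update A.up g₁ (some v₁)) g₂ (some v₁)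
      lo := Function.update (Function.update (Function.update
        (Function.update (Function.update A.lo e₁ (some v₂)) e₂ (some v₃))
          e₃ (some v₁)) g₁ (some v₂)) g₂ (some v₃) } := ⟨_, rfl⟩
  have BV : ∀ v, v ∈ B.V ↔ v ∈ insert v₃ A.V := by simp [hB]
  have BE : ∀ x, x ∈ B.E ↔ x ∈ insert g₁ (insert g₂ (A.E.erase e)) := by simp [hB]
  have Bη : ∀ v, B.η v = (Function.update (Function.update A.η v₁ .acUp) v₃ .aiUp : ℕ → FlowLabel) v := by simp [hB]
  have Bup : ∀ x, B.up x = (Function.update (Function.update A.up g₁ (some v₁)) g₂ (some v₁) : ℕ → Option ℕ) x := by simp [hB]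
  have Blo : ∀ x, B.lo x = (Function.update (Function.update (Function.update
        (Function.update (Function.update A.lo e₁ (some v₂)) e₂ (some v₃))
          e₃ (some v₁)) g₁ (some v₂)) g₂ (some v₃) : ℕ → Option ℕ) x := by simp [hB]
  simp only [Finset.mem_insert, Finset.mem_erase] at BV BE
  simp only [Function.update_apply] at Bη Bup Blo
  unfold endpointsOK at hends
  have L₁ : B.Ledges v₁ = {g₁, g₂} := by
    ext x
    rw [mem_Ledges, BE, Bup]
    grind
  have L₂ : B.Ledges v₂ = ∅ := by
    ext x
    rw [mem_Ledges, BE, Bup]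
    grind
  have L₃ : B.Ledges v₃ = ∅ := by
    ext x
    rw [mem_Ledges, BE, Bup]
    grind
  have U₁ : B.Uedges v₁ = {e₃} := by
    ext x
    rw [mem_Uedges, BE, Blo]
    grind
  have U₂ : B.Uedges v₂ = {e₁, g₁} := by
    ext x
    rw [mem_Uedges, BE, Blo]
    grind
  have U₃ : B.Uedges v₃ = {e₂, g₂} := by
    ext x
    rw [mem_Uedges, BE, Blo]
    grind
  have L' : ∀ v ∈ A.V, v ≠ v₁ → v ≠ v₂ → B.Ledges v = A.Ledges v := by
    intro v hv n₁ n₂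
    ext x
    rw [mem_Ledges, mem_Ledges, BE, Bup]
    grind
  have U' : ∀ v ∈ A.V, v ≠ v₁ → v ≠ v₂ → B.Uedges v = A.Uedges v := by
    intro v hv n₁ n₂
    ext x
    rw [mem_Uedges, mem_Uedges, BE, Blo]
    grind
  let π' : ℕ → Bool := fun x => if x = g₁ ∨ x = g₂ then false else π x
  let d' : ℕ → ℕ := d
  let ht' := Function.update (Function.update (Function.update ht v₁ (ht v₂)) v₂ (ht v₂ + 1)) v₃ (ht v₂ + 1)
  refine ⟨B, π', ht', d', ?_, ⟨?_, ?_, ?_⟩, ?_⟩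
  · refine .inl ⟨v₁, v₂, v₃, e, e₁, e₂, e₃, g₁, g₂, ?_⟩
    simp only [hB, true_and]
    grind
  · intro x hx
    rw [BE] at hx
    have hends' := hends x
    constructor <;> intro v hv <;> simp only [BV, Bup, Blo] at hv ⊢ <;> grind (splits := 15)
  · intro v hv
    have hv' : v = v₁ ∨ v = v₂ ∨ v = v₃ ∨ v ∈ A.V ∧ v ≠ v₁ ∧ v ≠ v₂ := by
      rw [BV] at hv
      grind
    rcases hv' with rfl | rfl | rfl | ⟨hvA, n₁, n₂⟩
    · have : B.η v = .acUp := by grind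
      rw [this, L₁, U₁, VertexOK.acUp_iff (by grind)]
      grind
    · have : B.η v = .aiUp := by grind
      rw [this, L₂, U₂, VertexOK.aiUp_iff (by grind)]
      grind
    · have : B.η v = .aiUp := by grind
      rw [this, L₃, U₃, VertexOK.aiUp_iff (by grind)]
      grind
    · have : B.η v = A.η v := by grind
      rw [this, L' v hvA n₁ n₂, U' v hvA n₁ n₂]
      refine (h.vert v hvA).congr (fun x hx => ?_) fun _ _ => rfl
      rw [Finset.mem_union, mem_Ledges, mem_Uedges] at hx
      grind
  · intro x hx u w hu hw
    have key := hheight x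
    have hu' := hends x
    rw [BE] at hx
    rw [Bup] at hu
    rw [Blo] at hw
    clear BV BE Bη Bup Blo hB L' U' L₁ L₂ L₃ U₁ U₂ U₃
    simp only [ht', Function.update_apply]
    rcases hx with rfl | rfl | ⟨hxe, hxA⟩
    all_goals grind (splits := 20)
  · refine weight_lt ∅ he ⟨hπ, v₁, hv₁e, .inl hη₁⟩ (fun x hx hh => ?_) ?_
    · obtain ⟨hp, v, hv, hk⟩ := hh
      rw [BE] at hx
      rw [Bup] at hv
      rw [Bη] at hk
      simp only [IsHeavy, Finset.notMem_empty]
      grind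
    · rw [Finset.sum_empty]
      grind

set_option maxHeartbeats 1000000 in
theorem exists_step_interaction_cocontraction {A : PreFlow} {π : ℕ → Bool} {ht : ℕ → ℤ}
    {d : ℕ → ℕ} (h : Graded A π ht d) {e v₁ v₂ : ℕ} (he : e ∈ A.E) (hπ : π e = true)
    (hv₁e : A.lo e = some v₁) (hv₂e : A.up e = some v₂)
    (hη₁ : A.η v₁ = .acUp) (hη₂ : A.η v₂ = .aiDown) :
    ∃ B π' ht' d', StepC A B ∧ Graded B π' ht' d' ∧ weight B π' d' < weight A π d := by
  have hends := h.ends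
  have hheight := h.height
  have hlt := h.height e he _ _ hv₂e hv₁e
  have hv₁ : v₁ ∈ A.V := (h.ends e he).2 _ hv₁e
  have hv₂ : v₂ ∈ A.V := (h.ends e he).1 _ hv₂e
  have hne : v₁ ≠ v₂ := by grind
  have ok₁ := h.vert v₁ hv₁
  have ok₂ := h.vert v₂ hv₂
  rw [hη₁] at ok₁
  rw [hη₂] at ok₂
  obtain ⟨e₁, e₂, h₁₂, hL₁⟩ := Finset.card_eq_two.1 ok₁.cardL
  obtain ⟨e₃, h₃, hL₂⟩ := exists_eq_pair ok₂.cardL (mem_Ledges.2 ⟨he, hv₂e⟩)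
  have hU₁ := exists_eq_singleton ok₁.cardU (mem_Uedges.2 ⟨he, hv₁e⟩)
  have hU₂ := Finset.card_eq_zero.1 ok₂.cardU
  rw [hL₁, hU₁, VertexOK.acUp_iff h₁₂] at ok₁
  rw [hL₂, hU₂, VertexOK.aiDown_iff h₃] at ok₂
  have mU₁ : ∀ x, x ∈ A.E ∧ A.lo x = some v₁ ↔ x = e := fun x => by
    rw [← mem_Uedges, hU₁]; simp
  have mL₁ : ∀ x, x ∈ A.E ∧ A.up x = some v₁ ↔ x = e₁ ∨ x = e₂ := fun x => by
    rw [← mem_Ledges, hL₁]; simp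
  have mU₂ : ∀ x, x ∈ A.E ∧ A.lo x = some v₂ ↔ False := fun x => by
    rw [← mem_Uedges, hU₂]; simp
  have mL₂ : ∀ x, x ∈ A.E ∧ A.up x = some v₂ ↔ x = e ∨ x = e₃ := fun x => by
    rw [← mem_Ledges, hL₂]; simp
  obtain ⟨v₃, hv₃⟩ := Infinite.exists_notMem_finset A.V
  obtain ⟨g₁, hg₁⟩ := Infinite.exists_notMem_finset A.E
  obtain ⟨g₂, hg₂⟩ := Infinite.exists_notMem_finset (insert g₁ A.E)
  simp only [Finset.mem_insert, not_or] at hg₂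
  obtain ⟨B, hB⟩ : ∃ B : PreFlow, B =
    { V := insert v₃ A.V
      E := insert g₁ (insert g₂ (A.E.erase e))
      η := Function.update (Function.update A.η v₁ .acDown) v₃ .aiDown
      up := Function.update (Function.update (Function.update
        (Function.update (Function.update A.up e₁ (some v₂)) e₂ (some v₃))
          e₃ (some v₁)) g₁ (some v₂)) g₂ (some v₃)
      lo := Function.update (Function.update A.lo g₁ (some v₁)) g₂ (some v₁) } := ⟨_, rfl⟩
  have BV : ∀ v, v ∈ B.V ↔ v ∈ insert v₃ A.V := by simp [hB]
  have BE : ∀ x, x ∈ B.E ↔ x ∈ insert g₁ (insert g₂ (A.E.erase e)) := by simp [hB]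
  have Bη : ∀ v, B.η v = (Function.update (Function.update A.η v₁ .acDown) v₃ .aiDown : ℕ → FlowLabel) v := by simp [hB]
  have Bup : ∀ x, B.up x = (Function.update (Function.update (Function.update
        (Function.update (Function.update A.up e₁ (some v₂)) e₂ (some v₃))
          e₃ (some v₁)) g₁ (some v₂)) g₂ (some v₃) : ℕ → Option ℕ) x := by simp [hB]
  have Blo : ∀ x, B.lo x = (Function.update (Function.update A.lo g₁ (some v₁)) g₂ (some v₁) : ℕ → Option ℕ) x := by simp [hB]
  simp only [Finset.mem_insert, Finset.mem_erase] at BV BE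
  simp only [Function.update_apply] at Bη Bup Blo
  unfold endpointsOK at hends
  have U₁ : B.Uedges v₁ = {g₁, g₂} := by
    ext x
    rw [mem_Uedges, BE, Blo]
    grind
  have U₂ : B.Uedges v₂ = ∅ := by
    ext x
    rw [mem_Uedges, BE, Blo]
    grind
  have U₃ : B.Uedges v₃ = ∅ := by
    ext x
    rw [mem_Uedges, BE, Blo]
    grind
  have L₁ : B.Ledges v₁ = {e₃} := by
    ext x
    rw [mem_Ledges, BE, Bup]
    grind
  have L₂ : B.Ledges v₂ = {e₁, g₁} := by
    ext x
    rw [mem_Ledges, BE, Bup]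
    grind
  have L₃ : B.Ledges v₃ = {e₂, g₂} := by
    ext x
    rw [mem_Ledges, BE, Bup]
    grind
  have L' : ∀ v ∈ A.V, v ≠ v₁ → v ≠ v₂ → B.Ledges v = A.Ledges v := by
    intro v hv n₁ n₂
    ext x
    rw [mem_Ledges, mem_Ledges, BE, Bup]
    grind
  have U' : ∀ v ∈ A.V, v ≠ v₁ → v ≠ v₂ → B.Uedges v = A.Uedges v := by
    intro v hv n₁ n₂
    ext x
    rw [mem_Uedges, mem_Uedges, BE, Blo]
    grind
  let π' : ℕ → Bool := fun x => if x = g₁ ∨ x = g₂ then false else π x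
  let d' : ℕ → ℕ := d
  let ht' := Function.update (Function.update (Function.update ht v₁ (ht v₂)) v₂ (ht v₂ - 1)) v₃ (ht v₂ - 1)
  refine ⟨B, π', ht', d', ?_, ⟨?_, ?_, ?_⟩, ?_⟩
  · refine .inr (.inl ⟨v₁, v₂, v₃, e, e₁, e₂, e₃, g₁, g₂, ?_⟩)
    simp only [hB, true_and]
    grind
  · intro x hx
    rw [BE] at hx
    have hends' := hends x
    constructor <;> intro v hv <;> simp only [BV, Bup, Blo] at hv ⊢ <;> grind (splits := 15)
  · intro v hv
    have hv' : v = v₁ ∨ v = v₂ ∨ v = v₃ ∨ v ∈ A.V ∧ v ≠ v₁ ∧ v ≠ v₂ := by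
      rw [BV] at hv
      grind
    rcases hv' with rfl | rfl | rfl | ⟨hvA, n₁, n₂⟩
    · have : B.η v = .acDown := by grind
      rw [this, L₁, U₁, VertexOK.acDown_iff (by grind)]
      grind
    · have : B.η v = .aiDown := by grind
      rw [this, L₂, U₂, VertexOK.aiDown_iff (by grind)]
      grind
    · have : B.η v = .aiDown := by grind
      rw [this, L₃, U₃, VertexOK.aiDown_iff (by grind)]
      grind
    · have : B.η v = A.η v := by grind
      rw [this, L' v hvA n₁ n₂, U' v hvA n₁ n₂]
      refine (h.vert v hvA).congr (fun x hx => ?_) fun _ _ => rfl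
      rw [Finset.mem_union, mem_Ledges, mem_Uedges] at hx
      grind
  · intro x hx u w hu hw
    have key := hheight x
    have hu' := hends x
    rw [BE] at hx
    rw [Bup] at hu
    rw [Blo] at hw
    clear BV BE Bη Bup Blo hB L' U' L₁ L₂ L₃ U₁ U₂ U₃
    simp only [ht', Function.update_apply]
    rcases hx with rfl | rfl | ⟨hxe, hxA⟩
    all_goals grind (splits := 20)
  · refine weight_lt {e₁, e₂} he ⟨hπ, v₂, hv₂e, .inr hη₂⟩ (fun x hx hh => ?_) ?_
    · obtain ⟨hp, v, hv, hk⟩ := hh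
      rw [BE] at hx
      rw [Bup] at hv
      rw [Bη] at hk
      simp only [IsHeavy, Finset.mem_insert, Finset.mem_singleton]
      grind
    · rw [Finset.sum_pair h₁₂]
      grind

/-- The vertex `u` is the upper endpoint and `w` the lower endpoint of some edge. -/
def IsAbove (A : PreFlow) (u w : ℕ) : Prop :=
  ∃ e ∈ A.E, A.up e = some u ∧ A.lo e = some w

theorem exists_chain_of_transGen {A : PreFlow} {u w : ℕ} (h : Relation.TransGen (IsAbove A) u w) :
    ∃ (n : ℕ) (ε : ℕ → ℕ), (∀ i ≤ n, ε i ∈ A.E) ∧ A.up (ε n) = some u ∧ A.lo (ε 0) = some w ∧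
      ∀ i < n, (A.up (ε i)).isSome ∧ A.up (ε i) = A.lo (ε (i + 1)) := by
  induction h with
  | single h =>
    obtain ⟨e, he, hu, hw⟩ := h
    exact ⟨0, fun _ => e, by simp [he], hu, hw, by simp⟩
  | tail _ h ih =>
    obtain ⟨n, ε, hE, hu, hw, hε⟩ := ih
    obtain ⟨e, he, hu', hw'⟩ := h
    refine ⟨n + 1, fun i => if i = 0 then e else ε (i - 1), ?_, ?_, ?_, ?_⟩
    · intro i hi
      rcases i with _ | i
      · simpa using he
      · simpa using hE i (by omega)
    · simpa using hu
    · simpa using hw'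
    · intro i hi
      rcases i with _ | i
      · simp [hu', hw]
      · simpa using hε i (by omega)

theorem not_transGen_self {A : PreFlow} (hA : A.Acyclic) (v : ℕ) :
    ¬ Relation.TransGen (IsAbove A) v v := by
  intro h
  obtain ⟨n, ε, hE, hu, hw, hε⟩ := exists_chain_of_transGen h
  refine hA ⟨n, fun i => ε i, fun i => hE i (by omega), fun i => ?_⟩
  rcases (Nat.lt_succ_iff_lt_or_eq.1 i.2) with hi | hi
  · have : ((i + 1 : Fin (n + 1)) : ℕ) = i + 1 := by
      rw [Fin.val_add_one_of_lt]
      exact Fin.lt_def.2 (by simpa using hi)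
    simpa [this] using hε i hi
  · have : i = Fin.last n := Fin.ext hi
    subst this
    simp [hu, hw]

/-- The number of vertices from which a downward path leads to `v`. -/
noncomputable def depth (A : PreFlow) (v : ℕ) : ℕ :=
  open Classical in (A.V.filter fun u => Relation.TransGen (IsAbove A) u v).card

theorem depth_le (A : PreFlow) (v : ℕ) : depth A v ≤ A.V.card := by
  classical
  exact Finset.card_filter_le _ _

theorem depth_lt {A : PreFlow} (hA : A.IsFlow) {e u w : ℕ} (he : e ∈ A.E) (hu : A.up e = some u)
    (hw : A.lo e = some w) : depth A u < depth A w := by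
  classical
  have huw : Relation.TransGen (IsAbove A) u w := .single ⟨e, he, hu, hw⟩
  unfold depth
  refine Finset.card_lt_card (Finset.ssubset_iff_of_subset ?_ |>.2 ⟨u, ?_, ?_⟩)
  · intro x hx
    rw [Finset.mem_filter] at hx ⊢
    exact ⟨hx.1, hx.2.trans huw⟩
  · exact Finset.mem_filter.2 ⟨(hA.2.1 e he).1 u hu, huw⟩
  · rw [Finset.mem_filter]
    exact fun h => not_transGen_self hA.2.2.1 u h.2

/-- Edge weights decreasing by a factor of at least three along each downward path. -/
noncomputable def initialWeight (A : PreFlow) (e : ℕ) : ℕ :=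
  match A.lo e with
  | none => 0
  | some v => 3 ^ (A.V.card - depth A v)

theorem exists_graded {A : PreFlow} (hA : A.IsFlow) : ∃ π ht d, Graded A π ht d := by
  obtain ⟨π, hπ⟩ := hA.2.2.2
  refine ⟨π, fun v => depth A v, initialWeight A, hA.2.1, fun v hv => ?_, fun e he u w hu hw => ?_⟩
  · obtain ⟨hcL, hcU⟩ := hA.1 v hv
    refine ⟨hcL, hcU, (hπ v hv).1, fun hk e he e' he' hne => ?_, fun e he _ => ?_⟩
    · obtain ⟨e₁, h₁, e₂, h₂, hp⟩ := (hπ v hv).2 hk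
      have hcard : (A.edges v).card ≤ 2 := by
        refine (Finset.card_union_le _ _).trans ?_
        rw [hcL, hcU]
        rcases hk with hk | hk <;> simp [hk, labDeg]
      have h₁₂ : e₁ ≠ e₂ := by rintro rfl; exact hp rfl
      have hsub : {e₁, e₂} = A.edges v := by
        refine Finset.eq_of_subset_of_card_le (by simp [Finset.insert_subset_iff, h₁, h₂]) ?_
        rwa [Finset.card_pair h₁₂]
      have m : e ∈ A.edges v := he
      have m' : e' ∈ A.edges v := he'
      rw [← hsub] at m m'
      grind
    · have hlow : ∀ x ∈ A.Ledges v, 3 * initialWeight A x ≤ initialWeight A e := by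
        intro x hx
        have hx' := mem_Ledges.1 hx
        have he' := mem_Uedges.1 he
        unfold initialWeight
        rw [he'.2]
        cases hw : A.lo x with
        | none => simp
        | some w =>
          have := depth_lt hA hx'.1 hx'.2 hw
          have := depth_le A w
          simp only
          rw [← pow_succ']
          exact Nat.pow_le_pow_right (by norm_num) (by omega)
      have hpos : 1 ≤ initialWeight A e := by
        unfold initialWeight
        rw [(mem_Uedges.1 he).2]
        exact Nat.one_le_pow _ _ (by norm_num)
      have hk : labExcess (A.η v) ≤ 1 := by cases A.η v <;> simp [labExcess]
      have hc : (A.Ledges v).card ≤ 2 := by rw [hcL]; cases A.η v <;> simp [labDeg]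
      have : 3 * ∑ x ∈ A.Ledges v, initialWeight A x ≤ 2 * initialWeight A e := by
        rw [Finset.mul_sum]
        refine (Finset.sum_le_card_nsmul _ _ _ hlow).trans ?_
        rw [smul_eq_mul]
        gcongr
      omega
  · exact_mod_cast depth_lt hA he hu hw

/-! ### Orientation of ai-paths -/

/-- The starting point of `e` when edges of polarity `s` are traversed downwards and
the others upwards. -/
def orientedSrc (A : PreFlow) (π : ℕ → Bool) (s : Bool) (e : ℕ) : VPt :=
  if π e = s then (A.up e).elim .top .ver else (A.lo e).elim .bot .ver

/-- The end point of `e` when edges of polarity `s` are traversed downwards and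
the others upwards. -/
def orientedTgt (A : PreFlow) (π : ℕ → Bool) (s : Bool) (e : ℕ) : VPt :=
  if π e = s then (A.lo e).elim .bot .ver else (A.up e).elim .top .ver

/-- `e'` starts at the vertex at which `e` ends. -/
def OrientedSucc (A : PreFlow) (π : ℕ → Bool) (s : Bool) (e e' : ℕ) : Prop :=
  ∃ v ∈ A.V, orientedTgt A π s e = .ver v ∧ orientedSrc A π s e' = .ver v

/-- `l` is a walk from `ν` to `ν'` in the orientation given by `s`. -/
structure OrientedWalk (A : PreFlow) (π : ℕ → Bool) (s : Bool) (ν ν' : VPt) (l : List ℕ) :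
    Prop where
  mem : ∀ e ∈ l, e ∈ A.E
  chain : l.IsChain (OrientedSucc A π s)
  head : ∃ e, l.head? = some e ∧ orientedSrc A π s e = ν
  last : ∃ e, l.getLast? = some e ∧ orientedTgt A π s e = ν'

section Orientation

variable {A : PreFlow} {π : ℕ → Bool} {ht : ℕ → ℤ} {d : ℕ → ℕ} {s : Bool} {ν ν' : VPt}

theorem orientedSrc_not (e : ℕ) : orientedSrc A π (!s) e = orientedTgt A π s e := by
  unfold orientedSrc orientedTgt
  cases π e <;> cases s <;> simp

theorem orientedTgt_not (e : ℕ) : orientedTgt A π (!s) e = orientedSrc A π s e := by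
  unfold orientedSrc orientedTgt
  cases π e <;> cases s <;> simp

theorem OrientedWalk.reverse {l : List ℕ} (h : OrientedWalk A π s ν ν' l) :
    OrientedWalk A π (!s) ν' ν l.reverse where
  mem e he := h.mem e (List.mem_reverse.1 he)
  chain := by
    rw [List.isChain_reverse]
    refine h.chain.imp fun a b hab => ?_
    obtain ⟨v, hv, ha, hb⟩ := hab
    exact ⟨v, hv, by rwa [orientedTgt_not], by rwa [orientedSrc_not]⟩
  head := by
    obtain ⟨e, he, ht⟩ := h.last
    exact ⟨e, by simpa using he, by rwa [orientedSrc_not]⟩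
  last := by
    obtain ⟨e, he, ht⟩ := h.head
    exact ⟨e, by simpa using he, by rwa [orientedTgt_not]⟩

theorem Graded.polarity_eq (h : Graded A π ht d) {e e' v : ℕ} (he : e ∈ A.E) (he' : e' ∈ A.E)
    (hlo : A.lo e = some v) (hup : A.up e' = some v) : π e = π e' := by
  have hv := (h.ends e he).2 v hlo
  have ok := h.vert v hv
  have hU := mem_Uedges.2 ⟨he, hlo⟩
  have hL := mem_Ledges.2 ⟨he', hup⟩
  have cU := ok.cardU ▸ Finset.card_pos.2 ⟨e, hU⟩
  have cL := ok.cardL ▸ Finset.card_pos.2 ⟨e', hL⟩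
  refine ok.polAc ?_ e (Finset.mem_union_right _ hU) e' (Finset.mem_union_left _ hL)
  cases hk : A.η v <;> simp_all [labDeg]

theorem Graded.isDownPath_walk (h : Graded A π ht d) {l : List ℕ} (hl : IsDownPath A ν ν' l) :
    ∃ s, OrientedWalk A π s ν ν' l := by
  obtain ⟨hne, hE, hc, hs, ht⟩ := hl
  have hpol : ∀ i, i < l.length → π (l.getD i 0) = π (l.getD 0 0) := by
    intro i
    induction i with
    | zero => simp
    | succ i ih =>
      intro hi
      obtain ⟨v, hv, h1, h2⟩ := hc i hi
      rw [← ih (by omega)]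
      refine (h.polarity_eq (hE _ ?_) (hE _ ?_) h1 h2).symm <;>
      · rw [List.getD_eq_getElem _ _ (by omega)]
        exact List.getElem_mem _
  have hpos := List.length_pos_of_ne_nil hne
  refine ⟨π (l.getD 0 0), hE, ?_, ⟨l.getD 0 0, ?_, ?_⟩, ⟨l.getD (l.length - 1) 0, ?_, ?_⟩⟩
  · rw [List.isChain_iff_getElem]
    intro i hi
    obtain ⟨v, hv, h1, h2⟩ := hc i hi
    have p1 := hpol i (by omega)
    have p2 := hpol (i + 1) hi
    rw [List.getD_eq_getElem _ _ (by omega)] at h1 h2 p1 p2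
    exact ⟨v, hv, by simp [orientedTgt, p1, h1], by simp [orientedSrc, p2, h2]⟩
  · rw [List.getD_eq_getElem _ _ hpos]
    simp [List.head?_eq_getElem?]
  · unfold srcOK at hs
    cases ν <;> simp_all [orientedSrc]
  · rw [List.getD_eq_getElem _ _ (by omega)]
    simp [List.getLast?_eq_getElem?, hpos]
  · unfold tgtOK at ht
    cases ν' <;> simp_all [orientedTgt]

theorem Graded.eq_of_meet (h : Graded A π ht d) {v e e' : ℕ} {s s' : Bool}
    (hk : A.η v = .aiDown ∨ A.η v = .aiUp) (hv : v ∈ A.V) (he : e ∈ A.E) (he' : e' ∈ A.E)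
    (hne : e ≠ e') (htgt : orientedTgt A π s e = .ver v)
    (hsrc : orientedSrc A π s' e' = .ver v) : s = s' := by
  have ok := h.vert v hv
  have mem : ∀ x ∈ A.E, A.up x = some v ∨ A.lo x = some v → x ∈ A.Ledges v ∪ A.Uedges v :=
    fun x hx => by
      rw [Finset.mem_union, mem_Ledges, mem_Uedges]
      tauto
  have empty : A.Ledges v = ∅ ∨ A.Uedges v = ∅ := by
    rcases hk with hk | hk
    · exact .inr (Finset.card_eq_zero.1 (by rw [ok.cardU, hk]; rfl))
    · exact .inl (Finset.card_eq_zero.1 (by rw [ok.cardL, hk]; rfl))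
  have pol := ok.polAi hk e
  have excl : ∀ x ∈ A.E, ∀ y ∈ A.E, A.up x = some v → A.lo y = some v → False :=
    fun x hx y hy h1 h2 => by
      have h3 := mem_Ledges.2 ⟨hx, h1⟩
      have h4 := mem_Uedges.2 ⟨hy, h2⟩
      rcases empty with h5 | h5 <;> simp_all
  unfold orientedTgt at htgt
  unfold orientedSrc at hsrc
  have el : ∀ o : Option ℕ, ∀ b, b ≠ .ver v → o.elim b VPt.ver = .ver v → o = some v := by
    intro o b hb ho
    cases o <;> simp_all
  split_ifs at htgt hsrc with h1 h2 h2 <;>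
  have t := el _ _ (by simp) htgt <;> have u := el _ _ (by simp) hsrc
  · exact (excl _ he' _ he u t).elim
  · have := pol (mem _ he (.inr t)) e' (mem _ he' (.inr u)) hne
    clear * - this h1 h2
    revert this h1 h2
    cases π e <;> cases π e' <;> cases s <;> cases s' <;> simp
  · have := pol (mem _ he (.inl t)) e' (mem _ he' (.inl u)) hne
    clear * - this h1 h2
    revert this h1 h2
    cases π e <;> cases π e' <;> cases s <;> cases s' <;> simp
  · exact (excl _ he _ he' t u).elim

theorem Graded.aiPath_walk (h : Graded A π ht d) {l : List ℕ} (hl : AIPath A ν ν' l) :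
    ∃ s, OrientedWalk A π s ν ν' l := by
  induction hl with
  | single hp =>
    rcases hp with hp | hp
    · exact h.isDownPath_walk hp
    · obtain ⟨s, hs⟩ := h.isDownPath_walk hp
      exact ⟨!s, by simpa using hs.reverse⟩
  | @join ν ν' v l₁ l₂ e e' hv hk _ _ hne ih₁ ih₂ =>
    obtain ⟨s, h₁⟩ := ih₁
    obtain ⟨s', h₂⟩ := ih₂
    have t : orientedTgt A π s e = .ver v := by simpa using h₁.last
    have u : orientedSrc A π s' e' = .ver v := by simpa using h₂.head
    obtain rfl : s = s' :=
      h.eq_of_meet hk hv (h₁.mem e (by simp)) (h₂.mem e' (by simp)) hne t u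
    refine ⟨s, fun x hx => ?_, ?_, ?_, ?_⟩
    · rcases List.mem_append.1 hx with hx | hx
      · exact h₁.mem x hx
      · exact h₂.mem x hx
    · refine h₁.chain.append h₂.chain ?_
      simp only [List.getLast?_concat, List.head?_cons, Option.mem_def, Option.some.injEq]
      rintro x rfl y rfl
      exact ⟨v, hv, t, u⟩
    · obtain ⟨x, hx, hx'⟩ := h₁.head
      exact ⟨x, by rw [List.head?_append, hx]; rfl, hx'⟩
    · obtain ⟨x, hx, hx'⟩ := h₂.last
      exact ⟨x, by rw [List.getLast?_append, hx]; rfl, hx'⟩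

theorem OrientedWalk.exists_succ {v : ℕ} {l : List ℕ} (hv : v ∈ A.V)
    (h : OrientedWalk A π s (.ver v) (.ver v) l) {e : ℕ} (he : e ∈ l) :
    ∃ e' ∈ l, OrientedSucc A π s e e' := by
  obtain ⟨i, hi, rfl⟩ := List.getElem_of_mem he
  by_cases hi' : i + 1 < l.length
  · exact ⟨l[i + 1], List.getElem_mem _, List.isChain_iff_getElem.1 h.chain i hi'⟩
  · obtain ⟨x, hx, hxs⟩ := h.head
    obtain ⟨y, hy, hyt⟩ := h.last
    refine ⟨x, List.mem_of_head? hx, v, hv, ?_, hxs⟩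
    rw [List.getLast?_eq_getElem?, List.getElem?_eq_some_iff] at hy
    obtain ⟨hy, rfl⟩ := hy
    have : i = l.length - 1 := by omega
    subst this
    exact hyt

end Orientation

/-! ### Flows without positive redexes -/

/-- No positive edge leads from a contraction or interaction vertex to a cocontraction or
cointeraction vertex, except from an interaction to a cointeraction vertex. -/
def NoPositiveRedex (A : PreFlow) (π : ℕ → Bool) : Prop :=
  ∀ e ∈ A.E, π e = true → ∀ u w, A.up e = some u → A.lo e = some w →
    (A.η u = .acDown ∨ A.η u = .aiDown) → (A.η w = .acUp ∨ A.η w = .aiUp) →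
      A.η u = .aiDown ∧ A.η w = .aiUp

section Cycles

variable {A : PreFlow} {π : ℕ → Bool} {ht : ℕ → ℤ} {d : ℕ → ℕ}

theorem orientedSrc_eq_ver {s : Bool} {e v : ℕ} :
    orientedSrc A π s e = .ver v ↔
      (π e = s ∧ A.up e = some v) ∨ (π e = (!s) ∧ A.lo e = some v) := by
  unfold orientedSrc
  cases hp : π e <;> cases s <;> cases hu : A.up e <;> cases hl : A.lo e <;> simp

theorem orientedTgt_eq_ver {s : Bool} {e v : ℕ} :
    orientedTgt A π s e = .ver v ↔
      (π e = s ∧ A.lo e = some v) ∨ (π e = (!s) ∧ A.up e = some v) := by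
  rw [← orientedSrc_not, orientedSrc_eq_ver]
  simp only [Bool.not_not]
  tauto

theorem Graded.label_of_through (h : Graded A π ht d) {e e' v : ℕ} (he : e ∈ A.E)
    (he' : e' ∈ A.E) (hlo : A.lo e = some v) (hup : A.up e' = some v) :
    A.η v = .acDown ∨ A.η v = .acUp := by
  have ok := h.vert v ((h.ends e he).2 v hlo)
  have cU := ok.cardU ▸ Finset.card_pos.2 ⟨e, mem_Uedges.2 ⟨he, hlo⟩⟩
  have cL := ok.cardL ▸ Finset.card_pos.2 ⟨e', mem_Ledges.2 ⟨he', hup⟩⟩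
  cases hk : A.η v <;> simp_all [labDeg]

theorem Graded.label_of_lo (h : Graded A π ht d) {e e' v : ℕ} (he : e ∈ A.E) (he' : e' ∈ A.E)
    (hp : π e ≠ π e') (hlo : A.lo e = some v) (hlo' : A.lo e' = some v) : A.η v = .aiUp := by
  have ok := h.vert v ((h.ends e he).2 v hlo)
  have m := mem_Uedges.2 ⟨he, hlo⟩
  have m' := mem_Uedges.2 ⟨he', hlo'⟩
  have cU := ok.cardU ▸ Finset.one_lt_card.2 ⟨e, m, e', m', fun h => hp (h ▸ rfl)⟩
  have pol := fun hk => hp (ok.polAc hk e (Finset.mem_union_right _ m) e'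
    (Finset.mem_union_right _ m'))
  cases hk : A.η v <;> simp_all [labDeg]

theorem Graded.label_of_up (h : Graded A π ht d) {e e' v : ℕ} (he : e ∈ A.E) (he' : e' ∈ A.E)
    (hp : π e ≠ π e') (hup : A.up e = some v) (hup' : A.up e' = some v) : A.η v = .aiDown := by
  have ok := h.vert v ((h.ends e he).1 v hup)
  have m := mem_Ledges.2 ⟨he, hup⟩
  have m' := mem_Ledges.2 ⟨he', hup'⟩
  have cL := ok.cardL ▸ Finset.one_lt_card.2 ⟨e, m, e', m', fun h => hp (h ▸ rfl)⟩
  have pol := fun hk => hp (ok.polAc hk e (Finset.mem_union_left _ m) e'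
    (Finset.mem_union_left _ m'))
  cases hk : A.η v <;> simp_all [labDeg]

theorem OrientedSucc.of_pos (h : Graded A π ht d) {e e' : ℕ} (he : e ∈ A.E) (he' : e' ∈ A.E)
    (hp : π e = true) (hs : OrientedSucc A π true e e') :
    ∃ v, A.lo e = some v ∧ ((π e' = true ∧ A.up e' = some v) ∨
      (π e' = false ∧ A.η v = .aiUp)) := by
  obtain ⟨v, -, h₁, h₂⟩ := hs
  rw [orientedTgt_eq_ver] at h₁
  rw [orientedSrc_eq_ver] at h₂
  have hlo : A.lo e = some v := by simpa [hp] using h₁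
  refine ⟨v, hlo, h₂.imp id fun h' => ⟨h'.1, ?_⟩⟩
  exact h.label_of_lo he he' (by simp [hp, h'.1]) hlo h'.2

theorem OrientedSucc.of_neg (h : Graded A π ht d) {e e' : ℕ} (he : e ∈ A.E) (he' : e' ∈ A.E)
    (hp : π e = false) (hs : OrientedSucc A π true e e') :
    ∃ v, A.up e = some v ∧ ((π e' = false ∧ A.lo e' = some v) ∨
      (π e' = true ∧ A.up e' = some v ∧ A.η v = .aiDown)) := by
  obtain ⟨v, -, h₁, h₂⟩ := hs
  rw [orientedTgt_eq_ver] at h₁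
  rw [orientedSrc_eq_ver] at h₂
  have hup : A.up e = some v := by simpa [hp] using h₁
  refine ⟨v, hup, h₂.symm.imp id fun h' => ⟨h'.1, h'.2, ?_⟩⟩
  exact h.label_of_up he he' (by simp [hp, h'.1]) hup h'.2

theorem simpleEdge_of_ends (h : Graded A π ht d) {e u w : ℕ} (he : e ∈ A.E)
    (hu : A.up e = some u) (hw : A.lo e = some w) (hηu : A.η u = .aiDown)
    (hηw : A.η w = .aiUp) : SimpleEdge A e :=
  ⟨u, w, (h.ends e he).1 u hu, (h.ends e he).2 w hw, .inl ⟨hηu, hηw⟩,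
    .inl ⟨by simp, by simpa using he, by simp, by simpa [srcOK] using hu,
      by simpa [tgtOK] using hw⟩⟩

/-- A nonempty set of edges closed under oriented successors contains a negative edge. -/
theorem Graded.exists_neg (h : Graded A π ht d) {S : Finset ℕ} (hS : S ⊆ A.E)
    (hne : S.Nonempty) (hsucc : ∀ e ∈ S, ∃ e' ∈ S, OrientedSucc A π true e e') :
    ∃ e ∈ S, π e = false := by
  by_contra! hpos
  simp only [ne_eq, Bool.not_eq_false] at hpos
  obtain ⟨e, he, hmax⟩ := S.exists_max_image (fun e => (A.lo e).elim 0 ht) hne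
  obtain ⟨e', he', hs⟩ := hsucc e he
  obtain ⟨v, hv, h₁ | h₁⟩ := hs.of_pos h (hS he) (hS he') (hpos e he)
  · obtain ⟨e'', he'', hs'⟩ := hsucc e' he'
    obtain ⟨w, hw, -⟩ := hs'.of_pos h (hS he') (hS he'') (hpos e' he')
    have := h.height e' (hS he') v w h₁.2 hw
    have := hmax e' he'
    simp only [hv, hw, Option.elim_some] at this
    omega
  · simp [hpos e' he'] at h₁

/-- A nonempty set of edges closed under oriented successors contains a positive edge
hanging from an interaction vertex. -/
theorem Graded.exists_pos_interaction (h : Graded A π ht d) {S : Finset ℕ} (hS : S ⊆ A.E)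
    (hne : S.Nonempty) (hsucc : ∀ e ∈ S, ∃ e' ∈ S, OrientedSucc A π true e e') :
    ∃ e ∈ S, π e = true ∧ ∃ u, A.up e = some u ∧ A.η u = .aiDown := by
  obtain ⟨e₀, he₀, hp₀⟩ := h.exists_neg hS hne hsucc
  obtain ⟨e, he, hmin⟩ := (S.filter (π · = false)).exists_min_image
    (fun e => (A.up e).elim 0 ht) ⟨e₀, Finset.mem_filter.2 ⟨he₀, hp₀⟩⟩
  obtain ⟨he, hp⟩ := Finset.mem_filter.1 he
  obtain ⟨e', he', hs⟩ := hsucc e he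
  obtain ⟨v, hv, h₁ | h₁⟩ := hs.of_neg h (hS he) (hS he') hp
  · obtain ⟨e'', he'', hs'⟩ := hsucc e' he'
    obtain ⟨u, hu, -⟩ := hs'.of_neg h (hS he') (hS he'') h₁.1
    have := h.height e' (hS he') u v hu h₁.2
    have := hmin e' (Finset.mem_filter.2 ⟨he', h₁.1⟩)
    simp only [hv, hu, Option.elim_some] at this
    omega
  · exact ⟨e', he', h₁.1, v, h₁.2⟩

theorem Graded.exists_simpleEdge_of_succ (h : Graded A π ht d) (hred : NoPositiveRedex A π)
    {S : Finset ℕ} (hS : S ⊆ A.E) (hne : S.Nonempty)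
    (hsucc : ∀ e ∈ S, ∃ e' ∈ S, OrientedSucc A π true e e') : ∃ e ∈ S, SimpleEdge A e := by
  classical
  let T := S.filter fun e => π e = true ∧ ∃ u, A.up e = some u ∧
    (A.η u = .acDown ∨ A.η u = .aiDown)
  have hT : T.Nonempty := by
    obtain ⟨e, he, hp, u, hu, hη⟩ := h.exists_pos_interaction hS hne hsucc
    exact ⟨e, Finset.mem_filter.2 ⟨he, hp, u, hu, .inr hη⟩⟩
  obtain ⟨e, he, hmax⟩ := T.exists_max_image (fun e => (A.up e).elim 0 ht) hT
  obtain ⟨he, hp, u, hu, hη⟩ := Finset.mem_filter.1 he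
  obtain ⟨e', he', hs⟩ := hsucc e he
  obtain ⟨w, hw, hs⟩ := hs.of_pos h (hS he) (hS he') hp
  by_cases hηw : A.η w = .acUp ∨ A.η w = .aiUp
  · obtain ⟨h₁, h₂⟩ := hred e (hS he) hp u w hu hw hη hηw
    exact ⟨e, he, simpleEdge_of_ends h (hS he) hu hw h₁ h₂⟩
  · rcases hs with hs | hs
    · have hdown := (h.label_of_through (hS he) (hS he') hw hs.2).resolve_right
        fun h' => hηw (.inl h')
      have := h.height e (hS he) u w hu hw
      have := hmax e' (Finset.mem_filter.2 ⟨he', hs.1, w, hs.2, .inl hdown⟩)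
      simp only [hu, hs.2, Option.elim_some] at this
      omega
    · exact absurd (.inr hs.2) hηw

/-- In a graded flow without positive redexes every closed ai-path contains a simple edge. -/
theorem Graded.exists_simpleEdge (h : Graded A π ht d) (hred : NoPositiveRedex A π) {v : ℕ}
    {l : List ℕ} (hv : v ∈ A.V) (hl : AIPath A (.ver v) (.ver v) l) :
    ∃ e ∈ l, SimpleEdge A e := by
  obtain ⟨l', hl', hw⟩ : ∃ l', (∀ e, e ∈ l' ↔ e ∈ l) ∧
      OrientedWalk A π true (.ver v) (.ver v) l' := by
    obtain ⟨s, hs⟩ := h.aiPath_walk hl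
    cases s
    · exact ⟨l.reverse, fun _ => List.mem_reverse, hs.reverse⟩
    · exact ⟨l, fun _ => Iff.rfl, hs⟩
  obtain ⟨e₀, he₀, -⟩ := hw.head
  obtain ⟨e, he, hse⟩ := h.exists_simpleEdge_of_succ hred (S := l'.toFinset)
    (fun e he => hw.mem e (List.mem_toFinset.1 he))
    ⟨e₀, List.mem_toFinset.2 (List.mem_of_head? he₀)⟩
    fun e he => by simpa using hw.exists_succ hv (List.mem_toFinset.1 he)
  exact ⟨e, (hl' e).1 (List.mem_toFinset.1 he), hse⟩

end Cycles

/-- A positive redex can be reduced by a step that decreases the weight. -/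
theorem Graded.exists_step {A : PreFlow} {π : ℕ → Bool} {ht : ℕ → ℤ} {d : ℕ → ℕ}
    (h : Graded A π ht d) (hred : ¬ NoPositiveRedex A π) :
    ∃ B π' ht' d', StepC A B ∧ Graded B π' ht' d' ∧ weight B π' d' < weight A π d := by
  unfold NoPositiveRedex at hred
  push Not at hred
  obtain ⟨e, he, hp, u, w, hu, hw, hηu, hηw, hne⟩ := hred
  rcases hηu with hηu | hηu <;> rcases hηw with hηw | hηw
  · exact exists_step_contraction_cocontraction h he hp hu hw hηu hηw
  · exact exists_step_contraction_cointeraction h he hp hu hw hηu hηw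
  · exact exists_step_interaction_cocontraction h he hp hw hu hηw hηu
  · exact absurd hηw (hne hηu)

theorem Graded.exists_reduction {A : PreFlow} {π : ℕ → Bool} {ht : ℕ → ℤ} {d : ℕ → ℕ}
    (h : Graded A π ht d) :
    ∃ B π' ht' d', Relation.ReflTransGen StepC A B ∧ Graded B π' ht' d' ∧
      NoPositiveRedex B π' := by
  induction hn : weight A π d using Nat.strong_induction_on generalizing A π ht d with
  | _ n ih =>
    by_cases hred : NoPositiveRedex A π
    · exact ⟨A, π, ht, d, .refl, h, hred⟩
    · obtain ⟨A', π', ht', d', hstep, h', hlt⟩ := h.exists_step hred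
      obtain ⟨B, πB, htB, dB, hAB, hB, hBred⟩ := ih _ (hn ▸ hlt) h' rfl
      exact ⟨B, πB, htB, dB, .head hstep hAB, hB, hBred⟩

end AF

namespace AF

/-- For every atomic flow `A` there is an atomic flow `B`
such that `A →c* B` and every ai-cycle of `B` is a fragile cycle, i.e.
contains a simple edge. -/
theorem statement_14 (A : PreFlow) (hA : A.IsFlow) :
    ∃ B : PreFlow, Relation.ReflTransGen StepC A B ∧
      ∀ v l, v ∈ B.V → AIPath B (.ver v) (.ver v) l → l.Nodup →
        ∃ e ∈ l, SimpleEdge B e := by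
  obtain ⟨π, ht, d, h⟩ := exists_graded hA
  obtain ⟨B, π', ht', d', hAB, hB, hred⟩ := h.exists_reduction
  exact ⟨B, hAB, fun v l hv hl _ => hB.exists_simpleEdge hred hv hl⟩

end AF
end

section
/- For every SKS derivation Φ, there exists an SKS derivation with the same premiss and the same conclusion as Φ whose associated atomic flow is cycle-free. -/
set_option linter.unusedVariables false

namespace AF

/-! ### The ai-free fragment is a distributive lattice -/

@[simp]
theorem Formula.sub_nil (φ : Formula) : φ.sub [] = some φ := by
  cases φ <;> rfl

@[simp]
theorem Formula.repl_nil (φ ψ : Formula) : φ.repl [] ψ = ψ := by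
  cases φ <;> rfl

namespace Derives

variable {S : Set RuleName} {α α' β β' γ δ : Formula}

theorem of_rule {r : RuleName} (hr : r ∈ S) (h : RuleInstance r α β) : Derives S α β :=
  .single ⟨r, hr, [], α, β, α.sub_nil, h, (α.repl_nil β).symm⟩

theorem trans (h : Derives S α β) (h' : Derives S β γ) : Derives S α γ :=
  Relation.ReflTransGen.trans h h'

theorem or_left (h : Derives S α α') : Derives S (.or α β) (.or α' β) :=
  h.lift (Formula.or · β) fun _ _ ⟨r, hr, q, γ, δ, h₁, h₂, h₃⟩ =>
    ⟨r, hr, false :: q, γ, δ, h₁, h₂, by rw [h₃]; rfl⟩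

theorem or_right (h : Derives S β β') : Derives S (.or α β) (.or α β') :=
  h.lift (Formula.or α ·) fun _ _ ⟨r, hr, q, γ, δ, h₁, h₂, h₃⟩ =>
    ⟨r, hr, true :: q, γ, δ, h₁, h₂, by rw [h₃]; rfl⟩

theorem and_left (h : Derives S α α') : Derives S (.and α β) (.and α' β) :=
  h.lift (Formula.and · β) fun _ _ ⟨r, hr, q, γ, δ, h₁, h₂, h₃⟩ =>
    ⟨r, hr, false :: q, γ, δ, h₁, h₂, by rw [h₃]; rfl⟩

theorem and_right (h : Derives S β β') : Derives S (.and α β) (.and α β') :=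
  h.lift (Formula.and α ·) fun _ _ ⟨r, hr, q, γ, δ, h₁, h₂, h₃⟩ =>
    ⟨r, hr, true :: q, γ, δ, h₁, h₂, by rw [h₃]; rfl⟩

theorem or_congr (h : Derives S α α') (h' : Derives S β β') :
    Derives S (.or α β) (.or α' β') :=
  h.or_left.trans h'.or_right

theorem and_congr (h : Derives S α α') (h' : Derives S β β') :
    Derives S (.and α β) (.and α' β') :=
  h.and_left.trans h'.and_right

end Derives

/-- A set of rules containing all rules other than interaction and cointeraction. -/
def HasAIFree (S : Set RuleName) : Prop :=
  ∀ r, r ≠ .aiDown → r ≠ .aiUp → r ∈ S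

namespace HasAIFree

open Derives

variable {S : Set RuleName} {α β γ δ : Formula}

theorem rule (hS : HasAIFree S) {r : RuleName} (h : RuleInstance r α β)
    (h₁ : r ≠ .aiDown := by decide) (h₂ : r ≠ .aiUp := by decide) : Derives S α β :=
  of_rule (hS r h₁ h₂) h

theorem bot_le (hS : HasAIFree S) : ∀ α, Derives S .ff α
  | .tt => (hS.rule (.awDown 0 true)).trans (hS.rule (.awUp 0 true))
  | .ff => .refl
  | .atom n b => hS.rule (.awDown n b)
  | .or α β => (hS.rule (.eqOrUnitAdd _)).trans (or_congr (bot_le hS α) (bot_le hS β))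
  | .and α β => (hS.rule .eqFFAdd).trans (and_congr (bot_le hS α) (bot_le hS β))

theorem le_top (hS : HasAIFree S) : ∀ α, Derives S α .tt
  | .tt => .refl
  | .ff => hS.bot_le _
  | .atom n b => hS.rule (.awUp n b)
  | .or α β => (or_congr (le_top hS α) (le_top hS β)).trans (hS.rule .eqTTDel)
  | .and α β => (and_congr (le_top hS α) (le_top hS β)).trans (hS.rule (.eqAndUnitDel _))

theorem or_exchange (hS : HasAIFree S) (α β γ δ : Formula) :
    Derives S (.or (.or α β) (.or γ δ)) (.or (.or α γ) (.or β δ)) :=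
  (hS.rule (.eqOrAssocL _ _ _)).trans <|
  (or_right <| (hS.rule (.eqOrAssocR _ _ _)).trans <|
    (or_left (hS.rule (.eqOrComm _ _))).trans <| hS.rule (.eqOrAssocL _ _ _)).trans <|
  hS.rule (.eqOrAssocR _ _ _)

theorem and_exchange (hS : HasAIFree S) (α β γ δ : Formula) :
    Derives S (.and (.and α β) (.and γ δ)) (.and (.and α γ) (.and β δ)) :=
  (hS.rule (.eqAndAssocL _ _ _)).trans <|
  (and_right <| (hS.rule (.eqAndAssocR _ _ _)).trans <|
    (and_left (hS.rule (.eqAndComm _ _))).trans <| hS.rule (.eqAndAssocL _ _ _)).trans <|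
  hS.rule (.eqAndAssocR _ _ _)

theorem contract (hS : HasAIFree S) : ∀ α, Derives S (.or α α) α
  | .tt => hS.rule .eqTTDel
  | .ff => hS.rule (.eqOrUnitDel _)
  | .atom n b => hS.rule (.acDown n b)
  | .or α β => (hS.or_exchange _ _ _ _).trans (or_congr (contract hS α) (contract hS β))
  | .and α β => (hS.rule (.m _ _ _ _)).trans (and_congr (contract hS α) (contract hS β))

theorem cocontract (hS : HasAIFree S) : ∀ α, Derives S α (.and α α)
  | .tt => hS.rule (.eqAndUnitAdd _)
  | .ff => hS.rule .eqFFAdd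
  | .atom n b => hS.rule (.acUp n b)
  | .or α β => (or_congr (cocontract hS α) (cocontract hS β)).trans (hS.rule (.m _ _ _ _))
  | .and α β => (and_congr (cocontract hS α) (cocontract hS β)).trans (hS.and_exchange _ _ _ _)

theorem or_comm (hS : HasAIFree S) (α β : Formula) : Derives S (.or α β) (.or β α) := hS.rule (.eqOrComm _ _)

theorem and_comm (hS : HasAIFree S) (α β : Formula) : Derives S (.and α β) (.and β α) := hS.rule (.eqAndComm _ _)

theorem le_or_left (hS : HasAIFree S) (α β : Formula) : Derives S α (.or α β) :=
  (hS.rule (.eqOrUnitAdd _)).trans (or_right (hS.bot_le _))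

theorem le_or_right (hS : HasAIFree S) (α β : Formula) : Derives S β (.or α β) :=
  (hS.le_or_left β α).trans (hS.or_comm _ _)

theorem and_le_left (hS : HasAIFree S) (α β : Formula) : Derives S (.and α β) α :=
  (and_right (hS.le_top _)).trans (hS.rule (.eqAndUnitDel _))

theorem and_le_right (hS : HasAIFree S) (α β : Formula) : Derives S (.and α β) β :=
  (hS.and_comm _ _).trans (hS.and_le_left β α)

theorem or_le (hS : HasAIFree S) (h : Derives S α γ) (h' : Derives S β γ) : Derives S (.or α β) γ :=
  (or_congr h h').trans (hS.contract _)

theorem le_and (hS : HasAIFree S) (h : Derives S γ α) (h' : Derives S γ β) : Derives S γ (.and α β) :=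
  (hS.cocontract _).trans (and_congr h h')

theorem and_or_distrib (hS : HasAIFree S) (α β γ : Formula) :
    Derives S (.and α (.or β γ)) (.or (.and α β) (.and α γ)) :=
  (and_left (hS.cocontract α)).trans <|
  (hS.rule (.eqAndAssocL _ _ _)).trans <|
  (and_right ((hS.rule (.s _ _ _)).trans (hS.or_comm _ _))).trans <|
  (hS.rule (.s _ _ _)).trans (hS.or_comm _ _)

theorem or_and_distrib (hS : HasAIFree S) (α β γ : Formula) :
    Derives S (.and (.or α β) (.or α γ)) (.or α (.and β γ)) :=
  (and_right (hS.or_comm α γ)).trans <|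
  (hS.rule (.s _ _ _)).trans <|
  (or_left <| (hS.and_comm _ _).trans <| (and_right (hS.or_comm _ _)).trans <|
    (hS.rule (.s _ _ _))).trans <|
  (hS.rule (.eqOrAssocL _ _ _)).trans <|
  (or_right (hS.contract _)).trans <|
  (hS.or_comm _ _).trans (or_right (hS.and_comm _ _))

end HasAIFree

/-! ### Interpolation: all cointeractions can precede all interactions -/

/-- `φ` derives `ψ` by a derivation in which no cointeraction follows an interaction. -/
def Interp (φ ψ : Formula) : Prop :=
  ∃ χ, Derives {r | r ≠ .aiDown} φ χ ∧ Derives {r | r ≠ .aiUp} χ ψ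

theorem hasAIFree_up : HasAIFree {r | r ≠ .aiDown} := fun _ h _ => h

theorem hasAIFree_down : HasAIFree {r | r ≠ .aiUp} := fun _ _ h => h

namespace Interp

variable {φ φ' ψ ψ' : Formula}

theorem pre (h : Derives {r | r ≠ .aiDown} φ φ') (h' : Interp φ' ψ) : Interp φ ψ :=
  let ⟨χ, h₁, h₂⟩ := h'
  ⟨χ, h.trans h₁, h₂⟩

theorem post (h : Interp φ ψ) (h' : Derives {r | r ≠ .aiUp} ψ ψ') : Interp φ ψ' :=
  let ⟨χ, h₁, h₂⟩ := h
  ⟨χ, h₁, h₂.trans h'⟩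

theorem or_le (h : Interp φ ψ) (h' : Interp φ' ψ) : Interp (.or φ φ') ψ :=
  let ⟨χ, h₁, h₂⟩ := h
  let ⟨χ', h₁', h₂'⟩ := h'
  ⟨.or χ χ', h₁.or_congr h₁', hasAIFree_down.or_le h₂ h₂'⟩

theorem le_and (h : Interp φ ψ) (h' : Interp φ ψ') : Interp φ (.and ψ ψ') :=
  let ⟨χ, h₁, h₂⟩ := h
  let ⟨χ', h₁', h₂'⟩ := h'
  ⟨.and χ χ', hasAIFree_up.le_and h₁ h₁', h₂.and_congr h₂'⟩

end Interp

/-- Conjunction of a list of literals. -/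
def conj (T : List (ℕ × Bool)) : Formula :=
  T.foldr (fun l χ => .and (.atom l.1 l.2) χ) .tt

/-- Disjunction of a list of literals. -/
def disj (C : List (ℕ × Bool)) : Formula :=
  C.foldr (fun l χ => .or (.atom l.1 l.2) χ) .ff

namespace Formula

/-- Truth of a formula when exactly the literals satisfying `P` are true. -/
def Sat (P : ℕ × Bool → Prop) : Formula → Prop
  | .tt => True
  | .ff => False
  | .atom n b => P (n, b)
  | .or α β => Sat P α ∨ Sat P β
  | .and α β => Sat P α ∧ Sat P β

theorem Sat.mono {P Q : ℕ × Bool → Prop} (h : ∀ l, P l → Q l) :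
    ∀ {φ : Formula}, φ.Sat P → φ.Sat Q
  | .tt => id
  | .ff => id
  | .atom _ _ => h _
  | .or _ _ => Or.imp (mono h) (mono h)
  | .and _ _ => And.imp (mono h) (mono h)

end Formula

namespace HasAIFree

variable {S : Set RuleName}

theorem conj_le (hS : HasAIFree S) {l : ℕ × Bool} : ∀ {T : List (ℕ × Bool)}, l ∈ T →
    Derives S (conj T) (.atom l.1 l.2)
  | a :: T, h => by
    rcases List.mem_cons.1 h with rfl | h
    · exact hS.and_le_left _ _
    · exact (hS.and_le_right _ _).trans (conj_le hS h)

theorem le_disj (hS : HasAIFree S) {l : ℕ × Bool} : ∀ {C : List (ℕ × Bool)}, l ∈ C →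
    Derives S (.atom l.1 l.2) (disj C)
  | a :: C, h => by
    rcases List.mem_cons.1 h with rfl | h
    · exact hS.le_or_left _ _
    · exact (le_disj hS h).trans (hS.le_or_right _ _)

end HasAIFree

namespace Interp

theorem of_terms {χ : Formula} : ∀ (φ θ : Formula) (T₀ : List (ℕ × Bool)),
    (∀ T, T₀ ⊆ T → φ.Sat (· ∈ T) → Interp (.and θ (conj T)) χ) →
    Interp (.and θ (.and φ (conj T₀))) χ
  | .tt, θ, T₀, h => (h T₀ (List.Subset.refl _) trivial).pre
      (Derives.and_right (hasAIFree_up.and_le_right _ _))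
  | .ff, θ, T₀, h => ⟨χ, (hasAIFree_up.and_le_right _ _).trans <|
      (hasAIFree_up.and_le_left _ _).trans (hasAIFree_up.bot_le _), .refl⟩
  | .atom n b, θ, T₀, h =>
      h ((n, b) :: T₀) (List.subset_cons_self _ _) List.mem_cons_self
  | .or α β, θ, T₀, h => by
      have hd := hasAIFree_up
      refine pre ?_ <| or_le
        (of_terms α θ T₀ fun T hT hα => h T hT (.inl hα))
        (of_terms β θ T₀ fun T hT hβ => h T hT (.inr hβ))
      exact Derives.trans (.and_right <| (hd.and_comm _ _).trans (hd.and_or_distrib _ _ _)) <|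
        (hd.and_or_distrib _ _ _).trans <|
        (hd.and_comm _ _).and_right.or_congr (hd.and_comm _ _).and_right
  | .and α β, θ, T₀, h => by
      have hd := hasAIFree_up
      refine pre ?_ <| of_terms α (.and θ β) T₀ fun T hT hα => pre ?_ <|
        of_terms β θ T fun T' hT' hβ => h T' (List.Subset.trans hT hT') ⟨hα.mono fun _ hl => hT' hl, hβ⟩
      · exact hd.le_and
          (hd.le_and (hd.and_le_left _ _) <| (hd.and_le_right _ _).trans <|
            (hd.and_le_left _ _).trans (hd.and_le_right _ _))
          ((hd.and_le_right _ _).trans (hd.and_le_left _ _).and_left)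
      · exact hd.rule (.eqAndAssocL _ _ _)

theorem of_clauses {χ : Formula} : ∀ (φ θ : Formula) (C₀ : List (ℕ × Bool)),
    (∀ C, C₀ ⊆ C → ¬ φ.Sat (· ∉ C) → Interp χ (.or θ (disj C))) →
    Interp χ (.or θ (.or φ (disj C₀)))
  | .ff, θ, C₀, h => (h C₀ (List.Subset.refl _) id).post
      (Derives.or_right (hasAIFree_down.le_or_right _ _))
  | .tt, θ, C₀, h => ⟨χ, .refl, (hasAIFree_down.le_top _).trans <|
      (hasAIFree_down.le_or_left _ _).trans (hasAIFree_down.le_or_right _ _)⟩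
  | .atom n b, θ, C₀, h =>
      h ((n, b) :: C₀) (List.subset_cons_self _ _) fun h => h List.mem_cons_self
  | .and α β, θ, C₀, h => by
      have hd := hasAIFree_down
      refine post (le_and
        (of_clauses α θ C₀ fun C hC hα => h C hC fun h => hα h.1)
        (of_clauses β θ C₀ fun C hC hβ => h C hC fun h => hβ h.2)) ?_
      exact ((hd.or_comm _ _).or_right.and_congr (hd.or_comm _ _).or_right).trans <|
        (hd.or_and_distrib _ _ _).trans <|
        Derives.or_right ((hd.or_and_distrib _ _ _).trans (hd.or_comm _ _))
  | .or α β, θ, C₀, h => by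
      have hd := hasAIFree_down
      refine post (of_clauses α (.or θ β) C₀ fun C hC hα => post
        (of_clauses β θ C fun C' hC' hβ => h C' (List.Subset.trans hC hC') ?_) ?_) ?_
      · rintro (h | h)
        · exact hα (h.mono fun _ hl hl' => hl (hC' hl'))
        · exact hβ h
      · exact hd.rule (.eqOrAssocR _ _ _)
      · exact hd.or_le
          (hd.or_le (hd.le_or_left _ _) <| (hd.le_or_right _ _).trans <|
            (hd.le_or_left _ _).trans (hd.le_or_right _ _))
          ((hd.le_or_left _ _).or_left.trans (hd.le_or_right _ _))

theorem conj_disj {T C : List (ℕ × Bool)}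
    (h : (∃ l, l ∈ T ∧ l ∈ C) ∨ (∃ n b, (n, b) ∈ T ∧ (n, !b) ∈ T) ∨
      ∃ n b, (n, b) ∈ C ∧ (n, !b) ∈ C) : Interp (conj T) (disj C) := by
  have hu := hasAIFree_up
  have hd := hasAIFree_down
  rcases h with ⟨l, h, h'⟩ | ⟨n, b, h, h'⟩ | ⟨n, b, h, h'⟩
  · exact ⟨_, hu.conj_le h, hd.le_disj h'⟩
  · refine ⟨.ff, (hu.le_and (hu.conj_le h) (hu.conj_le h')).trans ?_, hd.bot_le _⟩
    exact Derives.of_rule (by simp) (.aiUp n b)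
  · refine ⟨.tt, hu.le_top _, Derives.trans (β := .or (.atom n b) (.atom n (!b))) ?_
      (hd.or_le (hd.le_disj h) (hd.le_disj h'))⟩
    exact Derives.of_rule (by simp) (.aiDown n b)

/-- Completeness: a semantic consequence has a derivation with all cointeractions above
all interactions. -/
theorem of_entails {φ ψ : Formula}
    (h : ∀ v : ℕ → Bool, φ.Sat (fun l => v l.1 = l.2) → ψ.Sat (fun l => v l.1 = l.2)) :
    Interp φ ψ := by
  have hu := hasAIFree_up
  have hd := hasAIFree_down
  have key : ∀ T C : List (ℕ × Bool), φ.Sat (· ∈ T) → ¬ ψ.Sat (· ∉ C) →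
      Interp (conj T) (disj C) := by
    intro T C hT hC
    refine conj_disj ?_
    by_contra! hcon
    obtain ⟨h₁, h₂, h₃⟩ := hcon
    refine hC ((h (fun n => decide ((n, true) ∈ T ∨ (n, false) ∈ C))
      (hT.mono ?_)).mono ?_)
    · rintro ⟨n, _ | _⟩ hl
      · simpa using ⟨fun h => h₂ n true h hl, h₁ _ hl⟩
      · simpa using Or.inl hl
    · rintro ⟨n, _ | _⟩ hl hl'
      · simp [hl'] at hl
      · simp only [decide_eq_true_eq] at hl
        rcases hl with hl | hl
        · exact h₁ _ hl hl'
        · exact h₃ n true hl' hl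
  refine post (pre ?_ (of_terms φ .tt [] fun T _ hT => pre (hu.and_le_right _ _) <|
    post (of_clauses ψ .ff [] fun C _ hC => (key T C hT hC).post (hd.le_or_right _ _)) ?_)) .refl
  · exact hu.le_and (hu.le_top _) (hu.le_and .refl (hu.le_top _))
  · exact hd.or_le (hd.bot_le _) (hd.or_le .refl (hd.bot_le _))

end Interp

theorem RuleInstance.sound {r : RuleName} {α β : Formula} (h : RuleInstance r α β)
    (v : ℕ → Bool) : α.Sat (fun l => v l.1 = l.2) → β.Sat (fun l => v l.1 = l.2) := by
  cases h with
  | aiDown n b => cases h : v n <;> cases b <;> simp [Formula.Sat, h]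
  | aiUp n b => cases h : v n <;> cases b <;> simp [Formula.Sat, h]
  | _ => simp only [Formula.Sat]; grind

theorem Formula.sat_repl {P : ℕ × Bool → Prop} {γ δ : Formula} (h : γ.Sat P → δ.Sat P) :
    ∀ (φ : Formula) (q : List Bool), φ.sub q = some γ → φ.Sat P → (φ.repl q δ).Sat P
  | φ, [], h₁, h₂ => by cases φ <;> simp_all [sub, repl]
  | .or α β, false :: q, h₁, h₂ => Or.imp_left (sat_repl h α q h₁) h₂
  | .or α β, true :: q, h₁, h₂ => Or.imp_right (sat_repl h β q h₁) h₂
  | .and α β, false :: q, h₁, h₂ => And.imp_left (sat_repl h α q h₁) h₂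
  | .and α β, true :: q, h₁, h₂ => And.imp_right (sat_repl h β q h₁) h₂

theorem Deriv.WF.sound {Φ : Deriv} (hΦ : Φ.WF) (v : ℕ → Bool)
    (h : Φ.prem.Sat (fun l => v l.1 = l.2)) : Φ.concl.Sat (fun l => v l.1 = l.2) := by
  suffices ∀ i ≤ Φ.steps.length, (Φ.fml i).Sat (fun l => v l.1 = l.2) from this _ le_rfl
  intro i
  induction i with
  | zero => exact fun _ => h
  | succ i ih =>
    intro hi
    obtain ⟨γ, δ, h₁, h₂, h₃⟩ := hΦ i hi
    rw [h₃]
    exact Formula.sat_repl (h₂.sound v) _ _ h₁ (ih (Nat.le_of_succ_le hi))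

/-! ### Formulae whose atom occurrences are labelled with edges

A labelled formula is a `Formula` in which the name of an atom is the code of an edge. The code
records the time and position at which the edge was created, and the literal it carries. -/

def edgeCode (t : ℕ) (p : List Bool) (n : ℕ) (b : Bool) : ℕ :=
  Encodable.encode (t, p, n, b)

def edgeData (e : ℕ) : ℕ × List Bool × ℕ × Bool :=
  (Encodable.decode e).getD default

/-- The index of the formula in which the edge first occurs. -/
def edgeTime (e : ℕ) : ℕ := (edgeData e).1

def edgePos (e : ℕ) : List Bool := (edgeData e).2.1

def edgeName (e : ℕ) : ℕ := (edgeData e).2.2.1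

def edgePol (e : ℕ) : Bool := (edgeData e).2.2.2

@[simp]
theorem edgeData_edgeCode (t : ℕ) (p : List Bool) (n : ℕ) (b : Bool) :
    edgeData (edgeCode t p n b) = (t, p, n, b) := by
  simp [edgeData, edgeCode]

namespace Formula

/-- The formula underlying a labelled formula. -/
def erase : Formula → Formula
  | .tt => .tt
  | .ff => .ff
  | .atom e _ => .atom (edgeName e) (edgePol e)
  | .or α β => .or (erase α) (erase β)
  | .and α β => .and (erase α) (erase β)

/-- Label the atom occurrences of a formula with edges created at time `t`. -/
def label (t : ℕ) : List Bool → Formula → Formula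
  | _, .tt => .tt
  | _, .ff => .ff
  | p, .atom n b => .atom (edgeCode t p n b) b
  | p, .or α β => .or (label t (p ++ [false]) α) (label t (p ++ [true]) β)
  | p, .and α β => .and (label t (p ++ [false]) α) (label t (p ++ [true]) β)

/-- The edges labelling a labelled formula. -/
def edges : Formula → Multiset ℕ
  | .tt => 0
  | .ff => 0
  | .atom e _ => {e}
  | .or α β => edges α + edges β
  | .and α β => edges α + edges β

/-- The edge at a position of a labelled formula. -/
def edgeAt (φ : Formula) (p : List Bool) : ℕ :=
  match φ.sub p with
  | some (.atom e _) => e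
  | _ => 0

theorem erase_label (t : ℕ) : ∀ (p : List Bool) (φ : Formula), (label t p φ).erase = φ
  | _, .tt => rfl
  | _, .ff => rfl
  | p, .atom n b => by simp [label, erase, edgeName, edgePol]
  | p, .or α β => by simp [label, erase, erase_label t _ α, erase_label t _ β]
  | p, .and α β => by simp [label, erase, erase_label t _ α, erase_label t _ β]

theorem mem_edges_label {t e : ℕ} : ∀ {p : List Bool} {φ : Formula}, e ∈ (label t p φ).edges →
    edgeTime e = t ∧ p <+: edgePos e
  | _, .tt, h => by simp [label, edges] at h
  | _, .ff, h => by simp [label, edges] at h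
  | p, .atom n b, h => by
    obtain rfl : e = edgeCode t p n b := by simpa [label, edges] using h
    simp [edgeTime, edgePos]
  | p, .or α β, h => by
    rcases Multiset.mem_add.1 h with h | h
    all_goals exact (mem_edges_label h).imp_right ((List.prefix_append p _).trans ·)
  | p, .and α β, h => by
    rcases Multiset.mem_add.1 h with h | h
    all_goals exact (mem_edges_label h).imp_right ((List.prefix_append p _).trans ·)

theorem disjoint_edges_label (t : ℕ) (p : List Bool) (α β : Formula) :
    Disjoint (label t (p ++ [false]) α).edges (label t (p ++ [true]) β).edges := by
  rw [Multiset.disjoint_left]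
  intro e h h'
  obtain ⟨s, hs⟩ := (mem_edges_label h).2
  obtain ⟨s', hs'⟩ := (mem_edges_label h').2
  simpa using hs.trans hs'.symm

theorem nodup_edges_label (t : ℕ) : ∀ (p : List Bool) (φ : Formula), (label t p φ).edges.Nodup
  | _, .tt => Multiset.nodup_zero
  | _, .ff => Multiset.nodup_zero
  | _, .atom _ _ => Multiset.nodup_singleton _
  | p, .or α β => Multiset.nodup_add.2
      ⟨nodup_edges_label t _ α, nodup_edges_label t _ β, disjoint_edges_label t p α β⟩
  | p, .and α β => Multiset.nodup_add.2
      ⟨nodup_edges_label t _ α, nodup_edges_label t _ β, disjoint_edges_label t p α β⟩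

theorem sub_append (p : List Bool) : ∀ (φ : Formula) (q : List Bool),
    φ.sub (q ++ p) = (φ.sub q).bind (·.sub p)
  | φ, [] => by simp
  | .or α β, false :: q => sub_append p α q
  | .or α β, true :: q => sub_append p β q
  | .and α β, false :: q => sub_append p α q
  | .and α β, true :: q => sub_append p β q
  | .tt, c :: q | .ff, c :: q | .atom _ _, c :: q => by cases c <;> rfl

theorem sub_repl {γ δ : Formula} : ∀ {φ : Formula} {q : List Bool}, φ.sub q = some γ →
    (φ.repl q δ).sub q = some δ
  | φ, [], _ => by simp
  | .or α β, false :: q, h => sub_repl (φ := α) h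
  | .or α β, true :: q, h => sub_repl (φ := β) h
  | .and α β, false :: q, h => sub_repl (φ := α) h
  | .and α β, true :: q, h => sub_repl (φ := β) h

theorem sub_repl_of_not_prefix {γ δ : Formula} {n : ℕ} {b : Bool} :
    ∀ {φ : Formula} {q p : List Bool}, φ.sub q = some γ → ¬ q <+: p →
    φ.sub p = some (.atom n b) → (φ.repl q δ).sub p = some (.atom n b)
  | φ, [], p, _, h, _ => (h List.nil_prefix).elim
  | .or α β, c :: q, [], _, _, h | .and α β, c :: q, [], _, _, h => by simp at h
  | .or α β, false :: q, false :: p, h₁, h₂, h₃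
  | .and α β, false :: q, false :: p, h₁, h₂, h₃ =>
    sub_repl_of_not_prefix (φ := α) h₁ (fun h => h₂ (by simpa using h)) h₃
  | .or α β, true :: q, true :: p, h₁, h₂, h₃
  | .and α β, true :: q, true :: p, h₁, h₂, h₃ =>
    sub_repl_of_not_prefix (φ := β) h₁ (fun h => h₂ (by simpa using h)) h₃
  | .or α β, false :: q, true :: p, _, _, h | .or α β, true :: q, false :: p, _, _, h
  | .and α β, false :: q, true :: p, _, _, h | .and α β, true :: q, false :: p, _, _, h => h

theorem exists_edges_repl {γ : Formula} : ∀ {φ : Formula} {q : List Bool}, φ.sub q = some γ →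
    ∃ s, φ.edges = γ.edges + s ∧ ∀ δ, (φ.repl q δ).edges = δ.edges + s
  | φ, [], h => ⟨0, by simp_all⟩
  | .or α β, false :: q, h | .and α β, false :: q, h => by
    obtain ⟨s, h₁, h₂⟩ := exists_edges_repl (φ := α) h
    exact ⟨s + β.edges, by simp [edges, h₁, add_assoc], fun δ => by
      simp [edges, repl, h₂, add_assoc]⟩
  | .or α β, true :: q, h | .and α β, true :: q, h => by
    obtain ⟨s, h₁, h₂⟩ := exists_edges_repl (φ := β) h
    exact ⟨α.edges + s, by simp [edges, h₁, add_left_comm], fun δ => by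
      simp [edges, repl, h₂, add_left_comm]⟩

theorem sub_erase : ∀ (φ : Formula) (q : List Bool), φ.erase.sub q = (φ.sub q).map erase
  | φ, [] => by simp
  | .or α β, false :: q | .and α β, false :: q => sub_erase α q
  | .or α β, true :: q | .and α β, true :: q => sub_erase β q
  | .tt, c :: q | .ff, c :: q | .atom _ _, c :: q => by cases c <;> rfl

theorem erase_repl (δ : Formula) : ∀ (φ : Formula) (q : List Bool),
    (φ.repl q δ).erase = φ.erase.repl q δ.erase
  | φ, [] => by simp
  | .or α β, false :: q | .and α β, false :: q => by simp [repl, erase, erase_repl δ α q]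
  | .or α β, true :: q | .and α β, true :: q => by simp [repl, erase, erase_repl δ β q]
  | .tt, c :: q | .ff, c :: q | .atom _ _, c :: q => by cases c <;> rfl

theorem mem_edges_of_sub {e : ℕ} {b : Bool} : ∀ {φ : Formula} {p : List Bool},
    φ.sub p = some (.atom e b) → e ∈ φ.edges
  | φ, [], h => by simp_all [edges]
  | .or α β, false :: q, h | .and α β, false :: q, h =>
    Multiset.mem_add.2 (.inl (mem_edges_of_sub (φ := α) h))
  | .or α β, true :: q, h | .and α β, true :: q, h =>
    Multiset.mem_add.2 (.inr (mem_edges_of_sub (φ := β) h))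

theorem exists_sub_of_mem_edges {e : ℕ} : ∀ {φ : Formula}, e ∈ φ.edges →
    ∃ p b, φ.sub p = some (.atom e b)
  | .tt, h | .ff, h => by simp [edges] at h
  | .atom e' b, h => ⟨[], b, by simp_all [edges]⟩
  | .or α β, h | .and α β, h => by
    rcases Multiset.mem_add.1 h with h | h
    · obtain ⟨p, b, h⟩ := exists_sub_of_mem_edges h
      exact ⟨false :: p, b, h⟩
    · obtain ⟨p, b, h⟩ := exists_sub_of_mem_edges h
      exact ⟨true :: p, b, h⟩

theorem sub_atom_inj {e : ℕ} {b b' : Bool} : ∀ {φ : Formula} {p p' : List Bool},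
    φ.edges.Nodup → φ.sub p = some (.atom e b) → φ.sub p' = some (.atom e b') → p = p'
  | φ, [], p', _, h, h' => by
    obtain rfl : φ = .atom e b := by simpa using h
    cases p' with
    | nil => rfl
    | cons => simp [sub] at h'
  | .or α β, _ :: p, [], _, _, h' | .and α β, _ :: p, [], _, _, h' => by simp at h'
  | .or α β, false :: p, false :: p', hn, h, h' | .and α β, false :: p, false :: p', hn, h, h' =>
    congrArg _ (sub_atom_inj (φ := α) (Multiset.nodup_add.1 hn).1 h h')
  | .or α β, true :: p, true :: p', hn, h, h' | .and α β, true :: p, true :: p', hn, h, h' =>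
    congrArg _ (sub_atom_inj (φ := β) (Multiset.nodup_add.1 hn).2.1 h h')
  | .or α β, false :: p, true :: p', hn, h, h' | .and α β, false :: p, true :: p', hn, h, h' =>
    (Multiset.disjoint_left.1 (Multiset.nodup_add.1 hn).2.2 (mem_edges_of_sub (φ := α) h)
      (mem_edges_of_sub (φ := β) h')).elim
  | .or α β, true :: p, false :: p', hn, h, h' | .and α β, true :: p, false :: p', hn, h, h' =>
    (Multiset.disjoint_left.1 (Multiset.nodup_add.1 hn).2.2 (mem_edges_of_sub (φ := α) h')
      (mem_edges_of_sub (φ := β) h)).elim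

theorem edgeAt_of_sub {φ : Formula} {p : List Bool} {e : ℕ} {b : Bool}
    (h : φ.sub p = some (.atom e b)) : φ.edgeAt p = e := by
  simp [edgeAt, h]

theorem edgeAt_append {φ γ : Formula} {q : List Bool} (h : φ.sub q = some γ) (p : List Bool) :
    φ.edgeAt (q ++ p) = γ.edgeAt p := by
  simp [edgeAt, sub_append, h]

theorem isOcc_erase {φ : Formula} {p : List Bool} :
    φ.erase.IsOcc p ↔ ∃ b, φ.sub p = some (.atom (φ.edgeAt p) b) := by
  unfold IsOcc edgeAt
  rw [sub_erase]
  rcases φ.sub p with _ | (_ | _ | _ | _ | _) <;> simp [erase]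

theorem erase_eq_tt {φ : Formula} (h : φ.erase = .tt) : φ = .tt := by
  cases φ <;> simp_all [erase]

theorem erase_eq_ff {φ : Formula} (h : φ.erase = .ff) : φ = .ff := by
  cases φ <;> simp_all [erase]

theorem erase_eq_atom {φ : Formula} {n : ℕ} {b : Bool} (h : φ.erase = .atom n b) :
    ∃ e c, φ = .atom e c ∧ edgeName e = n ∧ edgePol e = b := by
  cases φ <;> simp_all [erase]

theorem erase_eq_or {φ α β : Formula} (h : φ.erase = .or α β) :
    ∃ α' β', φ = .or α' β' ∧ α'.erase = α ∧ β'.erase = β := by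
  cases φ <;> simp_all [erase]

theorem erase_eq_and {φ α β : Formula} (h : φ.erase = .and α β) :
    ∃ α' β', φ = .and α' β' ∧ α'.erase = α ∧ β'.erase = β := by
  cases φ <;> simp_all [erase]

end Formula

open Formula

theorem RuleInstance.edges_eq {r : RuleName} {γ δ : Formula} (h : RuleInstance r γ δ)
    (hr : r.isStructural = false) : δ.edges = γ.edges := by
  cases h <;> first | (cases hr; done) | (simp only [edges, add_zero] <;> abel)

/-- Logical and `=` rule instances lift to labelled formulae. -/
theorem RuleInstance.exists_lift {r : RuleName} {γ δ : Formula}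
    (h : RuleInstance r γ.erase δ) (hr : r.isStructural = false) :
    ∃ δ', RuleInstance r γ δ' ∧ δ'.erase = δ := by
  generalize hγ : γ.erase = γ' at h
  cases h with
  | aiDown | aiUp | awDown | awUp | acDown | acUp => cases hr
  | s α β γ =>
    obtain ⟨α, _, rfl, rfl, h⟩ := erase_eq_and hγ
    obtain ⟨β, γ, rfl, rfl, rfl⟩ := erase_eq_or h
    exact ⟨_, .s _ _ _, rfl⟩
  | m =>
    obtain ⟨_, _, rfl, h, h'⟩ := erase_eq_or hγ
    obtain ⟨α, β, rfl, rfl, rfl⟩ := erase_eq_and h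
    obtain ⟨γ, δ, rfl, rfl, rfl⟩ := erase_eq_and h'
    exact ⟨_, .m _ _ _ _, rfl⟩
  | eqOrComm =>
    obtain ⟨α, β, rfl, rfl, rfl⟩ := erase_eq_or hγ
    exact ⟨_, .eqOrComm _ _, rfl⟩
  | eqAndComm =>
    obtain ⟨α, β, rfl, rfl, rfl⟩ := erase_eq_and hγ
    exact ⟨_, .eqAndComm _ _, rfl⟩
  | eqOrAssocL =>
    obtain ⟨_, γ, rfl, h, rfl⟩ := erase_eq_or hγ
    obtain ⟨α, β, rfl, rfl, rfl⟩ := erase_eq_or h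
    exact ⟨_, .eqOrAssocL _ _ _, rfl⟩
  | eqOrAssocR =>
    obtain ⟨α, _, rfl, rfl, h⟩ := erase_eq_or hγ
    obtain ⟨β, γ, rfl, rfl, rfl⟩ := erase_eq_or h
    exact ⟨_, .eqOrAssocR _ _ _, rfl⟩
  | eqAndAssocL =>
    obtain ⟨_, γ, rfl, h, rfl⟩ := erase_eq_and hγ
    obtain ⟨α, β, rfl, rfl, rfl⟩ := erase_eq_and h
    exact ⟨_, .eqAndAssocL _ _ _, rfl⟩
  | eqAndAssocR =>
    obtain ⟨α, _, rfl, rfl, h⟩ := erase_eq_and hγ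
    obtain ⟨β, γ, rfl, rfl, rfl⟩ := erase_eq_and h
    exact ⟨_, .eqAndAssocR _ _ _, rfl⟩
  | eqOrUnitDel =>
    obtain ⟨α, _, rfl, rfl, h⟩ := erase_eq_or hγ
    obtain rfl := erase_eq_ff h
    exact ⟨_, .eqOrUnitDel _, rfl⟩
  | eqOrUnitAdd => exact ⟨_, .eqOrUnitAdd _, by simp [erase, hγ]⟩
  | eqAndUnitDel =>
    obtain ⟨α, _, rfl, rfl, h⟩ := erase_eq_and hγ
    obtain rfl := erase_eq_tt h
    exact ⟨_, .eqAndUnitDel _, rfl⟩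
  | eqAndUnitAdd => exact ⟨_, .eqAndUnitAdd _, by simp [erase, hγ]⟩
  | eqTTDel =>
    obtain ⟨_, _, rfl, h, h'⟩ := erase_eq_or hγ
    obtain rfl := erase_eq_tt h
    obtain rfl := erase_eq_tt h'
    exact ⟨_, .eqTTDel, rfl⟩
  | eqTTAdd =>
    obtain rfl := erase_eq_tt hγ
    exact ⟨_, .eqTTAdd, rfl⟩
  | eqFFDel =>
    obtain ⟨_, _, rfl, h, h'⟩ := erase_eq_and hγ
    obtain rfl := erase_eq_ff h
    obtain rfl := erase_eq_ff h'
    exact ⟨_, .eqFFDel, rfl⟩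
  | eqFFAdd =>
    obtain rfl := erase_eq_ff hγ
    exact ⟨_, .eqFFAdd, rfl⟩

/-- Structural rule instances between labelled formulae. -/
inductive StructuralInstance : RuleName → Formula → Formula → Prop
  | aiDown {d e : ℕ} {b c : Bool} (h : edgePol d = !edgePol e) :
      StructuralInstance .aiDown .tt (.or (.atom d b) (.atom e c))
  | aiUp {d e : ℕ} {b c : Bool} (h : edgePol d = !edgePol e) :
      StructuralInstance .aiUp (.and (.atom d b) (.atom e c)) .ff
  | awDown {e : ℕ} {b : Bool} : StructuralInstance .awDown .ff (.atom e b)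
  | awUp {e : ℕ} {b : Bool} : StructuralInstance .awUp (.atom e b) .tt
  | acDown {d e e' : ℕ} {b c c' : Bool} (h : edgePol e = edgePol d)
      (h' : edgePol e' = edgePol d) :
      StructuralInstance .acDown (.or (.atom e c) (.atom e' c')) (.atom d b)
  | acUp {d e e' : ℕ} {b c c' : Bool} (h : edgePol e = edgePol d)
      (h' : edgePol e' = edgePol d) :
      StructuralInstance .acUp (.atom d b) (.and (.atom e c) (.atom e' c'))

theorem RuleInstance.structuralInstance {r : RuleName} {γ δ : Formula}
    (h : RuleInstance r γ.erase δ.erase) (hr : r.isStructural = true) :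
    StructuralInstance r γ δ := by
  generalize hγ : γ.erase = γ', hδ : δ.erase = δ' at h
  cases h with
  | aiDown =>
    obtain rfl := erase_eq_tt hγ
    obtain ⟨_, _, rfl, h, h'⟩ := erase_eq_or hδ
    obtain ⟨d, b, rfl, -, h⟩ := erase_eq_atom h
    obtain ⟨e, c, rfl, -, h'⟩ := erase_eq_atom h'
    exact .aiDown (by simp [h, h'])
  | aiUp =>
    obtain rfl := erase_eq_ff hδ
    obtain ⟨_, _, rfl, h, h'⟩ := erase_eq_and hγ
    obtain ⟨d, b, rfl, -, h⟩ := erase_eq_atom h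
    obtain ⟨e, c, rfl, -, h'⟩ := erase_eq_atom h'
    exact .aiUp (by simp [h, h'])
  | awDown =>
    obtain rfl := erase_eq_ff hγ
    obtain ⟨e, c, rfl, -, -⟩ := erase_eq_atom hδ
    exact .awDown
  | awUp =>
    obtain rfl := erase_eq_tt hδ
    obtain ⟨e, c, rfl, -, -⟩ := erase_eq_atom hγ
    exact .awUp
  | acDown =>
    obtain ⟨d, b, rfl, -, rfl⟩ := erase_eq_atom hδ
    obtain ⟨_, _, rfl, h, h'⟩ := erase_eq_or hγ
    obtain ⟨e, c, rfl, -, h⟩ := erase_eq_atom h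
    obtain ⟨e', c', rfl, -, h'⟩ := erase_eq_atom h'
    exact .acDown h h'
  | acUp =>
    obtain ⟨d, b, rfl, -, rfl⟩ := erase_eq_atom hγ
    obtain ⟨_, _, rfl, h, h'⟩ := erase_eq_and hδ
    obtain ⟨e, c, rfl, -, h⟩ := erase_eq_atom h
    obtain ⟨e', c', rfl, -, h'⟩ := erase_eq_atom h'
    exact .acUp h h'
  | _ => cases hr

/-! ### A criterion for cycle-freeness

Orient the edges of a flow downwards if positive and upwards if negative. Every ai-path then
follows the orientation or its reverse, so a rank increasing along the orientation excludes
ai-cycles. -/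

/-- `e` points into `v`. -/
def PointsInto (A : PreFlow) (π : ℕ → Bool) (v e : ℕ) : Prop :=
  A.lo e = some v ∧ π e = true ∨ A.up e = some v ∧ π e = false

/-- `e` points out of `v`. -/
def PointsOut (A : PreFlow) (π : ℕ → Bool) (v e : ℕ) : Prop :=
  A.up e = some v ∧ π e = true ∨ A.lo e = some v ∧ π e = false

/-- `ρ` increases along the orientation of `A` given by `π`, and all ai-paths can be oriented. -/
structure IsRank (A : PreFlow) (π : ℕ → Bool) (ρ : ℕ → ℤ) : Prop where
  through : ∀ v ∈ A.V, ∀ e ∈ A.E, ∀ e' ∈ A.E, A.lo e = some v → A.up e' = some v → π e = π e'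
  not_into : ∀ v ∈ A.V, (A.η v = .aiDown ∨ A.η v = .aiUp) → ∀ e ∈ A.E, ∀ e' ∈ A.E, e ≠ e' →
    PointsInto A π v e → ¬ PointsInto A π v e'
  not_out : ∀ v ∈ A.V, (A.η v = .aiDown ∨ A.η v = .aiUp) → ∀ e ∈ A.E, ∀ e' ∈ A.E, e ≠ e' →
    PointsOut A π v e → ¬ PointsOut A π v e'
  lt : ∀ v ∈ A.V, ∀ e ∈ A.E, ∀ e' ∈ A.E, PointsInto A π v e → PointsOut A π v e' → ρ e < ρ e'

/-- The endpoints of an ai-path that follows the orientation. -/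
def Oriented (A : PreFlow) (π : ℕ → Bool) (ρ : ℕ → ℤ) (ν ν' : VPt) (l : List ℕ) : Prop :=
  ∃ a ∈ A.E, ∃ b ∈ A.E, l.head? = some a ∧ l.getLast? = some b ∧ ρ a ≤ ρ b ∧
    (∀ v, ν = .ver v → PointsOut A π v a) ∧ ∀ v, ν' = .ver v → PointsInto A π v b

namespace IsRank

variable {A : PreFlow} {π : ℕ → Bool} {ρ : ℕ → ℤ} {ν ν' : VPt} {l : List ℕ}

theorem oriented_of_isDownPath (h : IsRank A π ρ) (hl : IsDownPath A ν ν' l) :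
    Oriented A π ρ ν ν' l ∨ Oriented A π ρ ν' ν l.reverse := by
  obtain ⟨hne, hE, hstep, hsrc, htgt⟩ := hl
  have hpos : 0 < l.length := List.length_pos_iff.2 hne
  have hmem : ∀ i < l.length, l.getD i 0 ∈ A.E := fun i hi => by
    rw [List.getD_eq_getElem _ _ hi]
    exact hE _ (List.getElem_mem hi)
  have hρ : ∀ i < l.length, π (l.getD i 0) = π (l.getD 0 0) ∧
      (π (l.getD 0 0) = true → ρ (l.getD 0 0) ≤ ρ (l.getD i 0)) ∧
      (π (l.getD 0 0) = false → ρ (l.getD i 0) ≤ ρ (l.getD 0 0)) := by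
    intro i
    induction i with
    | zero => simp
    | succ i ih =>
      intro hi
      obtain ⟨h₁, h₂, h₃⟩ := ih (by omega)
      obtain ⟨v, hv, hlo, hup⟩ := hstep i hi
      have he := hmem i (by omega)
      have he' := hmem (i + 1) hi
      have hπ := h.through v hv _ he _ he' hlo hup
      refine ⟨by rw [← hπ, h₁], fun h₀ => (h₂ h₀).trans ?_, fun h₀ => le_trans ?_ (h₃ h₀)⟩
      · exact (h.lt v hv _ he _ he' (.inl ⟨hlo, h₁.trans h₀⟩)
          (.inl ⟨hup, hπ.symm.trans (h₁.trans h₀)⟩)).le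
      · exact (h.lt v hv _ he' _ he (.inr ⟨hup, hπ.symm.trans (h₁.trans h₀)⟩)
          (.inr ⟨hlo, h₁.trans h₀⟩)).le
  have hlast := hρ (l.length - 1) (by omega)
  have hhead : l.head? = some (l.getD 0 0) := by
    cases l with
    | nil => simp at hne
    | cons => simp
  have hget : l.getLast? = some (l.getD (l.length - 1) 0) := by
    rw [List.getLast?_eq_getElem?, List.getD_eq_getElem _ _ (by omega),
      List.getElem?_eq_getElem (by omega)]
  cases hπ : π (l.getD 0 0) with
  | true =>
    refine .inl ⟨_, hmem 0 hpos, _, hmem _ (by omega), hhead, hget, hlast.2.1 hπ, ?_, ?_⟩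
    · rintro v rfl
      exact .inl ⟨hsrc, hπ⟩
    · rintro v rfl
      exact .inl ⟨htgt, hlast.1.trans hπ⟩
  | false =>
    refine .inr ⟨_, hmem _ (by omega), _, hmem 0 hpos, by rw [List.head?_reverse, hget],
      by rw [List.getLast?_reverse, hhead], hlast.2.2 hπ, ?_, ?_⟩
    · rintro v rfl
      exact .inr ⟨htgt, hlast.1.trans hπ⟩
    · rintro v rfl
      exact .inr ⟨hsrc, hπ⟩

theorem oriented (h : IsRank A π ρ) (hl : AIPath A ν ν' l) :
    Oriented A π ρ ν ν' l ∨ Oriented A π ρ ν' ν l.reverse := by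
  induction hl with
  | single hl =>
    rcases hl with hl | hl
    · exact h.oriented_of_isDownPath hl
    · simpa using (h.oriented_of_isDownPath hl).symm
  | @join ν ν' v l₁ l₂ e e' hv hη _ _ hne ih₁ ih₂ =>
    rcases ih₁ with ⟨a, ha, b, hb, h₁, h₂, h₃, h₄, h₅⟩ | ⟨a, ha, b, hb, h₁, h₂, h₃, h₄, h₅⟩ <;>
    rcases ih₂ with ⟨a', ha', b', hb', h₁', h₂', h₃', h₄', h₅'⟩ |
      ⟨a', ha', b', hb', h₁', h₂', h₃', h₄', h₅'⟩
    · obtain rfl : e = b := by simpa using h₂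
      obtain rfl : e' = a' := by simpa using h₁'
      have := h.lt v hv _ hb _ ha' (h₅ v rfl) (h₄' v rfl)
      refine .inl ⟨a, ha, b', hb', ?_, ?_, by omega, h₄, h₅'⟩
      · rw [List.head?_append, h₁]; rfl
      · rw [List.getLast?_append, h₂']; rfl
    · obtain rfl : e = b := by simpa using h₂
      obtain rfl : e' = b' := by simpa using h₂'
      exact (h.not_into v hv hη _ hb _ hb' hne (h₅ v rfl) (h₅' v rfl)).elim
    · obtain rfl : e = a := by simpa using h₁
      obtain rfl : e' = a' := by simpa using h₁'
      exact (h.not_out v hv hη _ ha _ ha' hne (h₄ v rfl) (h₄' v rfl)).elim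
    · obtain rfl : e = a := by simpa using h₁
      obtain rfl : e' = b' := by simpa using h₂'
      have := h.lt v hv _ hb' _ ha (h₅' v rfl) (h₄ v rfl)
      refine .inr ⟨a', ha', b, hb, ?_, ?_, by omega, h₄', h₅⟩
      · rw [List.reverse_append, List.head?_append, h₁']; rfl
      · rw [List.reverse_append, List.getLast?_append, h₂]; rfl

theorem cycleFree (h : IsRank A π ρ) : CycleFree A := by
  rintro ⟨v, l, hv, hl, -⟩
  rcases h.oriented hl with ⟨a, ha, b, hb, -, -, hab, h₁, h₂⟩ | ⟨a, ha, b, hb, -, -, hab, h₁, h₂⟩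
  all_goals exact (h.lt v hv b hb a ha (h₂ v rfl) (h₁ v rfl)).not_ge hab

end IsRank

/-! ### Labelled derivations and their flows -/

theorem exists_labelled_step {r : RuleName} {q : List Bool} {φ ψ : Formula} (t : ℕ)
    (h : StepAt r q φ.erase ψ) :
    ∃ γ δ, φ.sub q = some γ ∧ (φ.repl q δ).erase = ψ ∧ RuleInstance r γ.erase δ.erase ∧
      (r.isStructural = false → RuleInstance r γ δ) ∧
      (r.isStructural = true → δ.edges.Nodup ∧ ∀ e ∈ δ.edges, edgeTime e = t) := by
  obtain ⟨γ', δ, h₁, h₂, rfl⟩ := h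
  rw [sub_erase, Option.map_eq_some_iff] at h₁
  obtain ⟨γ, h₁, rfl⟩ := h₁
  cases hr : r.isStructural with
  | true =>
    exact ⟨γ, label t [] δ, h₁, by rw [erase_repl, erase_label], by rwa [erase_label], by simp,
      fun _ => ⟨nodup_edges_label t [] δ, fun e he => (mem_edges_label he).1⟩⟩
  | false =>
    obtain ⟨δ', h₃, rfl⟩ := h₂.exists_lift hr
    exact ⟨γ, δ', h₁, erase_repl _ _ _, h₂, fun _ => h₃, by simp⟩

/-- A derivation of labelled formulae `X 0, …, X n`. Step `i` applies rule `R i` at position `Q i`,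
replacing `redex i` by `contr i`; a structural step creates fresh edges. -/
structure LabelledDeriv where
  n : ℕ
  X : ℕ → Formula
  R : ℕ → RuleName
  Q : ℕ → List Bool
  redex : ℕ → Formula
  contr : ℕ → Formula
  nodup_zero : (X 0).edges.Nodup
  time_zero : ∀ e ∈ (X 0).edges, edgeTime e = 0
  sub : ∀ i < n, (X i).sub (Q i) = some (redex i)
  succ : ∀ i < n, X (i + 1) = (X i).repl (Q i) (contr i)
  inst : ∀ i < n, RuleInstance (R i) (redex i).erase (contr i).erase
  logical : ∀ i < n, (R i).isStructural = false → RuleInstance (R i) (redex i) (contr i)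
  fresh : ∀ i < n, (R i).isStructural = true →
    (contr i).edges.Nodup ∧ ∀ e ∈ (contr i).edges, edgeTime e = i + 1

namespace LabelledDeriv

/-- The derivation without steps. -/
def ofFormula (φ : Formula) : LabelledDeriv where
  n := 0
  X _ := label 0 [] φ
  R _ := .s
  Q _ := []
  redex _ := φ
  contr _ := φ
  nodup_zero := nodup_edges_label 0 [] φ
  time_zero _ he := (mem_edges_label he).1
  sub _ h := absurd h (Nat.not_lt_zero _)
  succ _ h := absurd h (Nat.not_lt_zero _)
  inst _ h := absurd h (Nat.not_lt_zero _)
  logical _ h := absurd h (Nat.not_lt_zero _)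
  fresh _ h := absurd h (Nat.not_lt_zero _)

theorem exists_snoc (T : LabelledDeriv) {r : RuleName} {q : List Bool} {ψ : Formula}
    (h : StepAt r q (T.X T.n).erase ψ) :
    ∃ T' : LabelledDeriv, T'.n = T.n + 1 ∧ T'.X 0 = T.X 0 ∧ (∀ i < T.n, T'.R i = T.R i) ∧
      T'.R T.n = r ∧ (T'.X (T.n + 1)).erase = ψ := by
  obtain ⟨γ, δ, h₁, h₂, h₃, h₄, h₅⟩ := exists_labelled_step (T.n + 1) h
  have key : ∀ {P : ℕ → Prop}, (∀ i < T.n, P i) → P T.n → ∀ i < T.n + 1, P i := by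
    intro P hP hn i hi
    rcases Nat.lt_succ_iff_lt_or_eq.1 hi with hi | rfl
    exacts [hP i hi, hn]
  have hne : ∀ i < T.n, i ≠ T.n := fun i => Nat.ne_of_lt
  have hne' : ∀ i < T.n, i ≠ T.n + 1 := fun i hi => by omega
  refine ⟨{ n := T.n + 1
            X := Function.update T.X (T.n + 1) ((T.X T.n).repl q δ)
            R := Function.update T.R T.n r
            Q := Function.update T.Q T.n q
            redex := Function.update T.redex T.n γ
            contr := Function.update T.contr T.n δ
            nodup_zero := ?_
            time_zero := ?_
            sub := key (fun i hi => ?_) ?_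
            succ := key (fun i hi => ?_) ?_
            inst := key (fun i hi => ?_) ?_
            logical := key (fun i hi => ?_) ?_
            fresh := key (fun i hi => ?_) ?_ }, rfl, ?_, fun i hi => ?_, ?_, ?_⟩
  · simpa using T.nodup_zero
  · simpa using T.time_zero
  · simpa [hne i hi, hne' i hi] using T.sub i hi
  · simpa using h₁
  · simpa [hne i hi, hne' i hi] using T.succ i hi
  · simp
  · simpa [hne i hi] using T.inst i hi
  · simpa using h₃
  · simpa [hne i hi] using T.logical i hi
  · simpa using h₄
  · simpa [hne i hi] using T.fresh i hi
  · simpa using h₅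
  · simp
  · simp [hne i hi]
  · simp
  · simpa using h₂

theorem exists_of_derives (T : LabelledDeriv) {S : Set RuleName} {ψ : Formula}
    (h : Derives S (T.X T.n).erase ψ) :
    ∃ T' : LabelledDeriv, T.n ≤ T'.n ∧ T'.X 0 = T.X 0 ∧ (∀ i < T.n, T'.R i = T.R i) ∧
      (∀ i < T'.n, T.n ≤ i → T'.R i ∈ S) ∧ (T'.X T'.n).erase = ψ := by
  induction h with
  | refl => exact ⟨T, le_rfl, rfl, fun _ _ => rfl, fun i hi hi' => by omega, rfl⟩
  | tail _ h ih =>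
    obtain ⟨T', h₁, h₂, h₃, h₄, rfl⟩ := ih
    obtain ⟨r, hr, q, h⟩ := h
    obtain ⟨T'', h₁', h₂', h₃', h₄', h₅'⟩ := T'.exists_snoc h
    refine ⟨T'', by omega, h₂'.trans h₂, fun i hi => (h₃' i (by omega)).trans (h₃ i hi),
      fun i hi hi' => ?_, by rw [h₁', h₅']⟩
    rcases (show i < T'.n ∨ i = T'.n by omega) with hi | rfl
    · rw [h₃' i hi]
      exact h₄ i hi hi'
    · rwa [h₄']

variable (T : LabelledDeriv) {i j v e : ℕ}

theorem structuralInstance (hi : i < T.n) (hr : (T.R i).isStructural = true) :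
    StructuralInstance (T.R i) (T.redex i) (T.contr i) :=
  (T.inst i hi).structuralInstance hr

theorem edges_succ_of_logical (hi : i < T.n) (hr : (T.R i).isStructural = false) :
    (T.X (i + 1)).edges = (T.X i).edges := by
  obtain ⟨s, h₁, h₂⟩ := exists_edges_repl (T.sub i hi)
  rw [T.succ i hi, h₁, h₂, (T.logical i hi hr).edges_eq hr]

theorem nodup_edges_and_time_le (hi : i ≤ T.n) :
    (T.X i).edges.Nodup ∧ ∀ e ∈ (T.X i).edges, edgeTime e ≤ i := by
  induction i with
  | zero => exact ⟨T.nodup_zero, fun e he => (T.time_zero e he).le⟩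
  | succ i ih =>
    obtain ⟨ih₁, ih₂⟩ := ih (by omega)
    cases hr : (T.R i).isStructural with
    | false =>
      rw [T.edges_succ_of_logical hi hr]
      exact ⟨ih₁, fun e he => (ih₂ e he).trans (by omega)⟩
    | true =>
      obtain ⟨hn, ht⟩ := T.fresh i hi hr
      obtain ⟨s, h₁, h₂⟩ := exists_edges_repl (T.sub i hi)
      rw [T.succ i hi, h₂]
      rw [h₁] at ih₁ ih₂
      refine ⟨Multiset.nodup_add.2 ⟨hn, (Multiset.nodup_add.1 ih₁).2.1,
        Multiset.disjoint_left.2 fun {e} he he' => ?_⟩, fun e he => ?_⟩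
      · have := ht e he
        have := ih₂ e (Multiset.mem_add.2 (.inr he'))
        omega
      · rcases Multiset.mem_add.1 he with he | he
        · exact (ht e he).le
        · exact (ih₂ e (Multiset.mem_add.2 (.inr he))).trans (by omega)

theorem nodup_edges (hi : i ≤ T.n) : (T.X i).edges.Nodup := (T.nodup_edges_and_time_le hi).1

theorem time_le (hi : i ≤ T.n) (he : e ∈ (T.X i).edges) : edgeTime e ≤ i :=
  (T.nodup_edges_and_time_le hi).2 e he

theorem mem_edges_of_mem_redex (hi : i < T.n) (he : e ∈ (T.redex i).edges) :
    e ∈ (T.X i).edges := by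
  obtain ⟨s, h₁, -⟩ := exists_edges_repl (T.sub i hi)
  exact h₁ ▸ Multiset.mem_add.2 (.inl he)

theorem nodup_redex (hi : i < T.n) : (T.redex i).edges.Nodup := by
  obtain ⟨s, h₁, -⟩ := exists_edges_repl (T.sub i hi)
  exact (Multiset.nodup_add.1 (h₁ ▸ T.nodup_edges hi.le)).1

theorem mem_edges_succ (hi : i < T.n) :
    e ∈ (T.X (i + 1)).edges ↔
      e ∈ (T.contr i).edges ∨ e ∈ (T.X i).edges ∧ e ∉ (T.redex i).edges := by
  obtain ⟨s, h₁, h₂⟩ := exists_edges_repl (T.sub i hi)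
  have hd : e ∈ (T.redex i).edges → e ∉ s :=
    (Multiset.disjoint_left.1 (Multiset.nodup_add.1 (h₁ ▸ T.nodup_edges hi.le)).2.2 ·)
  rw [T.succ i hi, h₁, h₂, Multiset.mem_add, Multiset.mem_add]
  tauto

theorem mem_edges_of_time_le (hj : j ≤ T.n) (he : e ∈ (T.X j).edges) (hi : edgeTime e ≤ i)
    (hij : i ≤ j) : e ∈ (T.X i).edges := by
  induction j with
  | zero => rwa [Nat.le_zero.1 hij]
  | succ j ih =>
    rcases (show i = j + 1 ∨ i ≤ j by omega) with rfl | hij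
    · exact he
    · refine ih (by omega) ?_ hij
      cases hr : (T.R j).isStructural with
      | false => rwa [T.edges_succ_of_logical hj hr] at he
      | true =>
        rcases (T.mem_edges_succ hj).1 he with he | he
        · have := (T.fresh j hj hr).2 e he
          omega
        · exact he.1

theorem mem_contr_of_time_eq (hj : j ≤ T.n) (he : e ∈ (T.X j).edges) (ht : edgeTime e = v + 1) :
    v < T.n ∧ (T.R v).isStructural = true ∧ e ∈ (T.contr v).edges := by
  have hvj : v < j := (T.time_le hj he).trans_lt' (by omega)
  have hv : v < T.n := by omega
  have hmem := T.mem_edges_of_time_le hj he ht.le hvj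
  have hnot : e ∉ (T.X v).edges := fun h => by
    have := T.time_le hv.le h
    omega
  refine ⟨hv, ?_⟩
  cases hr : (T.R v).isStructural with
  | false => exact (hnot (T.edges_succ_of_logical hv hr ▸ hmem)).elim
  | true => exact ⟨rfl, ((T.mem_edges_succ hv).1 hmem).resolve_right fun h => hnot h.1⟩

/-- An edge that has been consumed does not occur again. -/
theorem not_mem_edges_of_mem_redex (hi : i < T.n) (hr : (T.R i).isStructural = true)
    (he : e ∈ (T.redex i).edges) (hj : j ≤ T.n) (hij : i < j) : e ∉ (T.X j).edges := by
  intro h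
  have hmem := T.mem_edges_of_mem_redex hi he
  have ht := T.time_le hi.le hmem
  rcases (T.mem_edges_succ hi).1 (T.mem_edges_of_time_le hj h (by omega) hij) with h | h
  · have := (T.fresh i hi hr).2 e h
    omega
  · exact h.2 he

theorem eq_of_mem_redex (hi : i < T.n) (hri : (T.R i).isStructural = true)
    (hei : e ∈ (T.redex i).edges) (hj : j < T.n) (hrj : (T.R j).isStructural = true)
    (hej : e ∈ (T.redex j).edges) : i = j := by
  rcases lt_trichotomy i j with h | h | h
  · exact (T.not_mem_edges_of_mem_redex hi hri hei hj.le h (T.mem_edges_of_mem_redex hj hej)).elim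
  · exact h
  · exact (T.not_mem_edges_of_mem_redex hj hrj hej hi.le h (T.mem_edges_of_mem_redex hi hei)).elim

/-- The derivation underlying a labelled derivation. -/
def deriv : Deriv :=
  ⟨(T.X 0).erase, (List.range T.n).map fun i => (T.R i, T.Q i, (T.X (i + 1)).erase)⟩

@[simp]
theorem length_steps_deriv : T.deriv.steps.length = T.n := by simp [deriv]

theorem fml_deriv (hi : i ≤ T.n) : T.deriv.fml i = (T.X i).erase := by
  cases i with
  | zero => rfl
  | succ i =>
    rw [Deriv.fml, List.getD_cons_succ, List.getD_eq_getElem _ _ (by simpa using hi)]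
    simp [deriv]

theorem stepAt_deriv (hi : i < T.n) :
    T.deriv.stepAt i = (T.R i, T.Q i, (T.X (i + 1)).erase) := by
  rw [Deriv.stepAt, List.getD_eq_getElem _ _ (by simpa using hi)]
  simp [deriv]

theorem wf_deriv : T.deriv.WF := by
  intro i hi
  rw [length_steps_deriv] at hi
  rw [T.stepAt_deriv hi, T.fml_deriv hi.le, T.fml_deriv hi]
  exact ⟨_, _, by rw [sub_erase, T.sub i hi]; rfl, T.inst i hi,
    by rw [T.succ i hi, erase_repl]⟩

theorem concl_deriv : T.deriv.concl = (T.X T.n).erase := by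
  rw [Deriv.concl, length_steps_deriv, T.fml_deriv le_rfl]

def vertexLabel : RuleName → FlowLabel
  | .aiDown => .aiDown
  | .aiUp => .aiUp
  | .awDown => .awDown
  | .awUp => .awUp
  | .acDown => .acDown
  | _ => .acUp

/-- Step `v` consumes the edge `e`. -/
def Consumes (v e : ℕ) : Prop :=
  v < T.n ∧ (T.R v).isStructural = true ∧ e ∈ (T.redex v).edges

open Classical in
/-- The flow of a labelled derivation; its vertices are the structural steps. -/
noncomputable def flow : PreFlow where
  V := (Finset.range T.n).filter fun v => (T.R v).isStructural = true
  E := (Finset.range (T.n + 1)).biUnion fun i => (T.X i).edges.toFinset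
  η v := vertexLabel (T.R v)
  up e := if edgeTime e = 0 then none else some (edgeTime e - 1)
  lo e := if h : ∃ v, T.Consumes v e then some h.choose else none

theorem mem_V : v ∈ T.flow.V ↔ v < T.n ∧ (T.R v).isStructural = true := by simp [flow]

theorem mem_E : e ∈ T.flow.E ↔ ∃ i ≤ T.n, e ∈ (T.X i).edges := by
  simp [flow, Order.lt_add_one_iff]

theorem up_eq_some : T.flow.up e = some v ↔ edgeTime e = v + 1 := by
  simp only [flow]
  split_ifs with h
  · simp [h]
  · simp only [Option.some.injEq]
    omega

theorem up_eq_none : T.flow.up e = none ↔ edgeTime e = 0 := by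
  simp [flow]

theorem lo_eq_some : T.flow.lo e = some v ↔ T.Consumes v e := by
  simp only [flow]
  split_ifs with h
  · obtain ⟨h₁, h₂, h₃⟩ := h.choose_spec
    simp only [Option.some.injEq]
    refine ⟨fun hv => hv ▸ h.choose_spec, fun ⟨h₁', h₂', h₃'⟩ => ?_⟩
    exact T.eq_of_mem_redex h₁ h₂ h₃ h₁' h₂' h₃'
  · simpa using fun hv => h ⟨v, hv⟩

theorem lo_eq_none_of_mem (he : e ∈ (T.X T.n).edges) : T.flow.lo e = none := by
  rw [Option.eq_none_iff_forall_ne_some]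
  intro v hv
  obtain ⟨h₁, h₂, h₃⟩ := T.lo_eq_some.1 hv
  exact T.not_mem_edges_of_mem_redex h₁ h₂ h₃ le_rfl h₁ he

theorem mem_E_of_mem_contr (hv : v ∈ T.flow.V) (he : e ∈ (T.contr v).edges) : e ∈ T.flow.E := by
  rw [mem_V] at hv
  exact T.mem_E.2 ⟨v + 1, hv.1, (T.mem_edges_succ hv.1).2 (.inl he)⟩

theorem mem_Ledges (hv : v ∈ T.flow.V) : e ∈ T.flow.Ledges v ↔ e ∈ (T.contr v).edges := by
  rw [PreFlow.Ledges, Finset.mem_filter, up_eq_some]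
  constructor
  · rintro ⟨he, ht⟩
    obtain ⟨i, hi, he⟩ := T.mem_E.1 he
    exact (T.mem_contr_of_time_eq hi he ht).2.2
  · intro he
    have hv' := T.mem_V.1 hv
    exact ⟨T.mem_E_of_mem_contr hv he, (T.fresh v hv'.1 hv'.2).2 e he⟩

theorem mem_Uedges (hv : v ∈ T.flow.V) : e ∈ T.flow.Uedges v ↔ e ∈ (T.redex v).edges := by
  rw [PreFlow.Uedges, Finset.mem_filter, lo_eq_some]
  rw [mem_V] at hv
  exact ⟨fun h => h.2.2.2, fun he => ⟨T.mem_E.2 ⟨v, hv.1.le, T.mem_edges_of_mem_redex hv.1 he⟩,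
    hv.1, hv.2, he⟩⟩

theorem card_Ledges (hv : v ∈ T.flow.V) :
    (T.flow.Ledges v).card = (T.contr v).edges.card := by
  have hv' := T.mem_V.1 hv
  rw [← Multiset.toFinset_card_of_nodup (T.fresh v hv'.1 hv'.2).1]
  congr 1
  ext e
  rw [T.mem_Ledges hv, Multiset.mem_toFinset]

theorem card_Uedges (hv : v ∈ T.flow.V) :
    (T.flow.Uedges v).card = (T.redex v).edges.card := by
  rw [← Multiset.toFinset_card_of_nodup (T.nodup_redex (T.mem_V.1 hv).1)]
  congr 1
  ext e
  rw [T.mem_Uedges hv, Multiset.mem_toFinset]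

theorem mem_flow_edges (hv : v ∈ T.flow.V) :
    e ∈ T.flow.edges v ↔ e ∈ (T.contr v).edges ∨ e ∈ (T.redex v).edges := by
  rw [PreFlow.edges, Finset.mem_union, T.mem_Ledges hv, T.mem_Uedges hv]

theorem degOK : T.flow.degOK := by
  intro v hv
  rw [T.card_Ledges hv, T.card_Uedges hv]
  have h := T.structuralInstance (T.mem_V.1 hv).1 (T.mem_V.1 hv).2
  have hη : T.flow.η v = vertexLabel (T.R v) := rfl
  rw [hη]
  generalize T.R v = r, T.redex v = γ, T.contr v = δ at h
  cases h <;> simp [edges, vertexLabel, labDeg]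

theorem endpointsOK : T.flow.endpointsOK := by
  intro e he
  obtain ⟨i, hi, he⟩ := T.mem_E.1 he
  refine ⟨fun v hv => ?_, fun v hv => ?_⟩
  · have := T.mem_contr_of_time_eq hi he (T.up_eq_some.1 hv)
    exact T.mem_V.2 ⟨this.1, this.2.1⟩
  · have := T.lo_eq_some.1 hv
    exact T.mem_V.2 ⟨this.1, this.2.1⟩

theorem acyclic : T.flow.Acyclic := by
  rintro ⟨h, ε, -, hε⟩
  have hlt : ∀ i, edgeTime (ε (i + 1)) < edgeTime (ε i) := by
    intro i
    obtain ⟨h₁, h₂⟩ := hε i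
    obtain ⟨v, hv⟩ := Option.isSome_iff_exists.1 h₁
    obtain ⟨h₃, -, h₄⟩ := T.lo_eq_some.1 (h₂.symm.trans hv)
    have := T.time_le h₃.le (T.mem_edges_of_mem_redex h₃ h₄)
    have := T.up_eq_some.1 hv
    omega
  obtain ⟨i, hi⟩ := Finite.exists_min fun i => edgeTime (ε i)
  exact (hlt i).not_ge (hi (i + 1))

theorem polarityOK : T.flow.PolarityOK edgePol := by
  intro v hv
  have h := T.structuralInstance (T.mem_V.1 hv).1 (T.mem_V.1 hv).2
  have hη : T.flow.η v = vertexLabel (T.R v) := rfl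
  simp only [T.mem_flow_edges hv, hη]
  clear hη
  generalize T.R v = r, T.redex v = γ, T.contr v = δ at h
  cases h <;>
    simp only [edges, Multiset.mem_add, Multiset.mem_singleton, Multiset.notMem_zero,
      vertexLabel] <;>
    grind

theorem isFlow : T.flow.IsFlow := ⟨T.degOK, T.endpointsOK, T.acyclic, edgePol, T.polarityOK⟩

/-- The edge at an atom occurrence. -/
def edge (i : ℕ) (p : List Bool) : ℕ := (T.X i).edgeAt p

theorem mem_edges_of_isOcc {p : List Bool} (hp : (T.X i).erase.IsOcc p) :
    T.edge i p ∈ (T.X i).edges := by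
  obtain ⟨b, h⟩ := isOcc_erase.1 hp
  exact mem_edges_of_sub h

theorem edge_append (hi : i < T.n) (p : List Bool) :
    T.edge i (T.Q i ++ p) = (T.redex i).edgeAt p :=
  edgeAt_append (T.sub i hi) p

theorem edge_succ_append (hi : i < T.n) (p : List Bool) :
    T.edge (i + 1) (T.Q i ++ p) = (T.contr i).edgeAt p := by
  rw [edge, T.succ i hi]
  exact edgeAt_append (sub_repl (T.sub i hi)) p

theorem up_of_mem_contr (hi : i < T.n) (hr : (T.R i).isStructural = true)
    (he : e ∈ (T.contr i).edges) : T.flow.up e = some i :=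
  T.up_eq_some.2 ((T.fresh i hi hr).2 e he)

theorem lo_of_mem_redex (hi : i < T.n) (hr : (T.R i).isStructural = true)
    (he : e ∈ (T.redex i).edges) : T.flow.lo e = some i :=
  T.lo_eq_some.2 ⟨hi, hr, he⟩

theorem edge_succ_of_not_prefix (hi : i < T.n) {p : List Bool} (hp : ¬ T.Q i <+: p)
    (h : (T.X i).erase.IsOcc p) : T.edge (i + 1) p = T.edge i p := by
  obtain ⟨b, h⟩ := isOcc_erase.1 h
  refine edgeAt_of_sub (b := b) ?_
  rw [T.succ i hi]
  exact sub_repl_of_not_prefix (T.sub i hi) hp h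

theorem corrCond_edge (hi : i < T.n) {ψ : Formula} {cs : List (List Bool × List Bool)}
    (h : ∀ c ∈ cs, ∀ p, (T.contr i).edgeAt (c.1 ++ p) = (T.redex i).edgeAt (c.2 ++ p)) :
    corrCond T.edge i (T.Q i) ψ cs := by
  intro c hc p _
  rw [List.append_assoc, List.append_assoc, T.edge_succ_append hi, T.edge_append hi, h c hc]

theorem stepCond_edge (hi : i < T.n) :
    stepCond T.flow T.edge i i (T.R i) (T.Q i) (T.X i).erase (T.X (i + 1)).erase := by
  refine ⟨fun p => T.edge_succ_of_not_prefix hi, ?_⟩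
  have hη : T.flow.η i = vertexLabel (T.R i) := rfl
  have hQ := T.edge_append hi []
  have hQ' := T.edge_succ_append hi []
  rw [List.append_nil] at hQ hQ'
  simp only [T.edge_append hi, T.edge_succ_append hi, hQ, hQ', hη]
  cases hr : (T.R i).isStructural with
  | true =>
    have h := T.structuralInstance hi hr
    have hup := fun e => T.up_of_mem_contr (e := e) hi hr
    have hlo := fun e => T.lo_of_mem_redex (e := e) hi hr
    have hn := (T.fresh i hi hr).1
    have hn' := T.nodup_redex hi
    generalize T.R i = r, T.redex i = γ, T.contr i = δ at h hup hlo hn hn'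
    cases h <;> simp_all [edges, vertexLabel, edgeAt, Formula.sub]
  | false =>
    have h := T.logical i hi hr
    have hc := fun cs => T.corrCond_edge (cs := cs) hi (ψ := (T.X (i + 1)).erase)
    generalize T.R i = r, T.redex i = γ, T.contr i = δ at h hc hr
    cases h <;> first
      | trivial
      | cases hr; done
      | (refine hc _ ?_
         simp [edgeAt, Formula.sub])

theorem isAssocFlow : IsAssocFlow T.deriv T.flow T.edge id := by
  have hnf : ∀ {i}, i < T.deriv.nf → i ≤ T.n := fun {i} hi => by
    rw [Deriv.nf, length_steps_deriv] at hi
    omega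
  refine ⟨T.wf_deriv, T.isFlow, fun i p hi hp => ?_, fun e he => ?_, fun i p p' hi hp hp' h => ?_,
    fun p hp => ?_, fun p hp => ?_, fun i hi hr => ?_, fun v hv => ?_, fun i j _ _ _ _ h => h,
    fun i hi => ?_⟩
  · rw [T.fml_deriv (hnf hi)] at hp
    exact T.mem_E.2 ⟨i, hnf hi, T.mem_edges_of_isOcc hp⟩
  · obtain ⟨i, hi, he⟩ := T.mem_E.1 he
    obtain ⟨p, b, h⟩ := exists_sub_of_mem_edges he
    have hp := edgeAt_of_sub h
    refine ⟨i, p, by rw [Deriv.nf, length_steps_deriv]; omega, ?_, hp⟩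
    rw [T.fml_deriv hi, isOcc_erase]
    exact ⟨b, by rw [hp, h]⟩
  · rw [T.fml_deriv (hnf hi), isOcc_erase] at hp hp'
    obtain ⟨b, hp⟩ := hp
    obtain ⟨b', hp'⟩ := hp'
    exact sub_atom_inj (T.nodup_edges (hnf hi)) hp (hp'.trans (by rw [edge, edge] at h; rw [h]))
  · rw [T.fml_deriv (Nat.zero_le _)] at hp
    exact T.up_eq_none.2 (T.time_zero _ (T.mem_edges_of_isOcc hp))
  · rw [length_steps_deriv] at hp ⊢
    rw [T.fml_deriv le_rfl] at hp
    exact T.lo_eq_none_of_mem (T.mem_edges_of_isOcc hp)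
  · rw [length_steps_deriv] at hi
    rw [T.stepAt_deriv hi] at hr
    exact T.mem_V.2 ⟨hi, hr⟩
  · obtain ⟨h₁, h₂⟩ := T.mem_V.1 hv
    exact ⟨v, by simpa using h₁, by rwa [T.stepAt_deriv h₁], rfl⟩
  · rw [length_steps_deriv] at hi
    rw [T.stepAt_deriv hi, T.fml_deriv hi.le, T.fml_deriv hi]
    exact T.stepCond_edge hi

/-- If all interactions come after all cuts, the flow is cycle-free. -/
theorem cycleFree_flow {k : ℕ} (h₁ : ∀ i < T.n, i < k → T.R i ≠ .aiDown)
    (h₂ : ∀ i < T.n, k ≤ i → T.R i ≠ .aiUp) : CycleFree T.flow := by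
  have hlo : ∀ {v e}, T.flow.lo e = some v → e ∈ (T.redex v).edges ∧ edgeTime e ≤ v := by
    intro v e h
    obtain ⟨hv, -, he⟩ := T.lo_eq_some.1 h
    exact ⟨he, T.time_le hv.le (T.mem_edges_of_mem_redex hv he)⟩
  have hup : ∀ {v e}, e ∈ T.flow.E → T.flow.up e = some v →
      e ∈ (T.contr v).edges ∧ edgeTime e = v + 1 := by
    intro v e he h
    obtain ⟨i, hi, he⟩ := T.mem_E.1 he
    have ht := T.up_eq_some.1 h
    exact ⟨(T.mem_contr_of_time_eq hi he ht).2.2, ht⟩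
  let M : ℤ := T.n + 1
  have hrank : IsRank T.flow edgePol fun e =>
      if edgePol e then (if edgeTime e ≤ k then (edgeTime e : ℤ) else 2 * M + edgeTime e)
      else (if edgeTime e ≤ k then 4 * M - edgeTime e else 2 * M - edgeTime e) := by
    constructor
    · intro v hv e he e' he' hl hu
      have h := T.structuralInstance (T.mem_V.1 hv).1 (T.mem_V.1 hv).2
      replace hl := (hlo hl).1
      replace hu := (hup he' hu).1
      generalize T.R v = r, T.redex v = γ, T.contr v = δ at h hl hu
      cases h <;>
        simp only [edges, Multiset.mem_add, Multiset.mem_singleton, Multiset.notMem_zero]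
          at hl hu <;>
        grind
    · intro v hv hη e he e' he' hne hi hi'
      have h := T.structuralInstance (T.mem_V.1 hv).1 (T.mem_V.1 hv).2
      replace hi := hi.imp (And.imp_left fun h => (hlo h).1) (And.imp_left fun h => (hup he h).1)
      replace hi' := hi'.imp (And.imp_left fun h => (hlo h).1) (And.imp_left fun h => (hup he' h).1)
      change vertexLabel (T.R v) = _ ∨ vertexLabel (T.R v) = _ at hη
      generalize T.R v = r, T.redex v = γ, T.contr v = δ at h hi hi' hη
      cases h <;>
        simp only [edges, Multiset.mem_add, Multiset.mem_singleton, Multiset.notMem_zero,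
          vertexLabel] at hi hi' hη <;>
        grind
    · intro v hv hη e he e' he' hne hi hi'
      have h := T.structuralInstance (T.mem_V.1 hv).1 (T.mem_V.1 hv).2
      replace hi := hi.imp (And.imp_left fun h => (hup he h).1) (And.imp_left fun h => (hlo h).1)
      replace hi' := hi'.imp (And.imp_left fun h => (hup he' h).1) (And.imp_left fun h => (hlo h).1)
      change vertexLabel (T.R v) = _ ∨ vertexLabel (T.R v) = _ at hη
      generalize T.R v = r, T.redex v = γ, T.contr v = δ at h hi hi' hη
      cases h <;>
        simp only [edges, Multiset.mem_add, Multiset.mem_singleton, Multiset.notMem_zero,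
          vertexLabel] at hi hi' hη <;>
        grind
    · intro v hv e he e' he' hi hi'
      have hvn := (T.mem_V.1 hv).1
      have h := T.structuralInstance hvn (T.mem_V.1 hv).2
      replace hi := hi.imp (And.imp_left hlo) (And.imp_left (hup he))
      replace hi' := hi'.imp (And.imp_left (hup he')) (And.imp_left hlo)
      replace h₁ := h₁ v hvn
      replace h₂ := h₂ v hvn
      generalize T.R v = r, T.redex v = γ, T.contr v = δ at h hi hi' h₁ h₂
      cases h <;>
        simp only [edges, Multiset.mem_add, Multiset.mem_singleton, Multiset.notMem_zero]
          at hi hi' h₁ h₂ <;>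
        grind
  exact hrank.cycleFree

end LabelledDeriv

/-- For every SKS derivation `Φ` there exists an SKS
derivation with the same premiss and the same conclusion as `Φ` whose
associated atomic flow is cycle-free. -/
theorem statement_17 (Φ : Deriv) (hΦ : Φ.WF) :
    ∃ Ψ : Deriv, Ψ.WF ∧ Ψ.prem = Φ.prem ∧ Ψ.concl = Φ.concl ∧
      ∃ A f g, IsAssocFlow Ψ A f g ∧ CycleFree A := by
  obtain ⟨χ, h₁, h₂⟩ := Interp.of_entails fun v => hΦ.sound v
  obtain ⟨T, -, hX, -, hR, rfl⟩ := (LabelledDeriv.ofFormula Φ.prem).exists_of_derives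
    (S := {r | r ≠ .aiDown}) (ψ := χ) (by simpa [LabelledDeriv.ofFormula, erase_label] using h₁)
  obtain ⟨T', -, hX', hRT, hR', hψ⟩ := T.exists_of_derives h₂
  refine ⟨T'.deriv, T'.wf_deriv, ?_, T'.concl_deriv.trans hψ, T'.flow, T'.edge, id,
    T'.isAssocFlow, T'.cycleFree_flow (k := T.n) (fun i _ hi => ?_) hR'⟩
  · change (T'.X 0).erase = Φ.prem
    rw [hX', hX]
    exact erase_label _ _ _
  · rw [hRT i hi]
    exact hR i hi (Nat.zero_le _)

end AF
end
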